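/- arXiv:0812.5039 — 4 statements merged into one kernel-verified Lean document; each statement's English description precedes it below -/
import Mathlib

section
/- For every integer d ≥ 2 there exists a constant c > 0 (depending only on d) such that for every real r ≥ 2 there exists a finite point set X ⊂ ℝ^d with the property that every weak (1/r)-net N for X with respect to convex sets satisfies |N| ≥ c · r · (log r)^{d−1}. -/
open Classical in
/-- `N` is a weak `ε`-net for the finite set `X ⊂ ℝ^d` with respect to convex sets:
`N` intersects every convex set `C` containing at least `ε|X|` points of `X`. -/
def IsWeakNet {d : ℕ} (X : Finset (Fin d → ℝ)) (ε : ℝ) (N : Set (Fin d → ℝ)) : Prop :=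
  ∀ C : Set (Fin d → ℝ), Convex ℝ C →
    ε * X.card ≤ (X.filter (fun p => p ∈ C)).card → (N ∩ C).Nonempty

/-- The point `(d ^ y₁, …, d ^ y_d)` of the exponentially stretched grid in `ℝ^d`. -/
def stretch {d : ℕ} (y : Fin d → ℕ) : Fin d → ℝ := fun j => (d : ℝ) ^ y j

theorem stretch_injective {d : ℕ} (hd : 2 ≤ d) : Function.Injective (stretch (d := d)) := by
  intro y z h
  funext j
  have hd' : (1 : ℝ) < d := by exact_mod_cast hd
  exact pow_right_injective₀ (by linarith) hd'.ne' (congrFun h j)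

/-- The stretched grid with `m ^ d` points. -/
noncomputable def stretchedGrid (d m : ℕ) : Finset (Fin d → ℝ) :=
  (Fintype.piFinset fun _ : Fin d => Finset.range m).image stretch

theorem card_stretchedGrid {d : ℕ} (hd : 2 ≤ d) (m : ℕ) : (stretchedGrid d m).card = m ^ d := by
  rw [stretchedGrid, Finset.card_image_of_injective _ (stretch_injective hd)]
  simp

/-- A point in the convex hull of a set `S` of points with positive coordinates dominates, up to
the factor `d`, some point of `S`. -/
theorem exists_le_mul_of_mem_convexHull {d : ℕ} {S : Set (Fin d → ℝ)}
    (hS : ∀ y ∈ S, ∀ j, 0 < y j) {q : Fin d → ℝ} (hq : q ∈ convexHull ℝ S) :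
    ∃ y ∈ S, ∀ j, y j ≤ d * q j := by
  have hpos : ∀ j, 0 < q j := by
    intro j
    have hconv : Convex ℝ {x : Fin d → ℝ | 0 < x j} :=
      convex_halfSpace_gt (LinearMap.proj (R := ℝ) (φ := fun _ : Fin d => ℝ) j).isLinear 0
    exact convexHull_min (fun y hy => hS y hy j) hconv hq
  by_contra! h
  let f : (Fin d → ℝ) →ₗ[ℝ] ℝ := ∑ j, (q j)⁻¹ • LinearMap.proj j
  have hf : ∀ x, f x = ∑ j, (q j)⁻¹ * x j := fun x => by simp [f]
  have hlt : (d : ℝ) < f q := by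
    refine convexHull_min (fun y hy => ?_) (convex_halfSpace_gt f.isLinear (d : ℝ)) hq
    obtain ⟨j, hj⟩ := h y hy
    change (d : ℝ) < f y
    rw [hf]
    have hle : (q j)⁻¹ * y j ≤ ∑ i, (q i)⁻¹ * y i :=
      Finset.single_le_sum (f := fun i => (q i)⁻¹ * y i)
        (fun i _ => mul_nonneg (inv_nonneg.2 (hpos i).le) (hS y hy i).le) (Finset.mem_univ j)
    refine lt_of_lt_of_le ?_ hle
    rw [inv_mul_eq_div, lt_div_iff₀ (hpos j)]
    exact hj
  have heq : f q = d := by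
    rw [hf, Finset.sum_congr rfl fun j _ => inv_mul_cancel₀ (hpos j).ne']
    simp
  exact hlt.ne' heq

theorem apply_le_of_mem_convexHull {d : ℕ} {S : Set (Fin d → ℝ)} {b : Fin d → ℝ}
    (hS : ∀ y ∈ S, y ≤ b) {q : Fin d → ℝ} (hq : q ∈ convexHull ℝ S) : q ≤ b :=
  convexHull_min (t := Set.Iic b) hS (convex_Iic b) hq

/-- The box of side lengths `w` with upper corner `p` contains, up to constant factors in the
stretched coordinates, a point of `N`. -/
def BoxHits {d : ℕ} (N : Finset (Fin d → ℝ)) (p w : Fin d → ℕ) : Prop :=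
  ∃ q ∈ N, ∀ j, q j ≤ (d : ℝ) ^ p j ∧ (d : ℝ) ^ p j ≤ (d : ℝ) ^ w j * q j

/-- The points of the stretched grid lying in those boxes with upper corner `p` and side lengths
in `W` that are not hit by `N`. -/
def unhitCorner {d : ℕ} (N : Finset (Fin d → ℝ)) (W : Set (Fin d → ℕ)) (p : Fin d → ℕ) :
    Set (Fin d → ℝ) :=
  {x | ∃ y w, stretch y = x ∧ w ∈ W ∧ ¬ BoxHits N p w ∧ ∀ j, y j ≤ p j ∧ p j < y j + w j}

theorem disjoint_convexHull_unhitCorner {d : ℕ} (hd : 2 ≤ d) (N : Finset (Fin d → ℝ))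
    (W : Set (Fin d → ℕ)) (p : Fin d → ℕ) :
    Disjoint (↑N : Set (Fin d → ℝ)) (convexHull ℝ (unhitCorner N W p)) := by
  have hd' : (1 : ℝ) < d := by exact_mod_cast hd
  have hd0 : (0 : ℝ) < d := by linarith
  rw [Set.disjoint_left]
  intro q hqN hq
  obtain ⟨x, ⟨y, w, rfl, -, hhit, hy⟩, hxq⟩ := exists_le_mul_of_mem_convexHull
    (by rintro _ ⟨y, w, rfl, -⟩ j; exact pow_pos hd0 _) hq
  have hqp : q ≤ stretch p := apply_le_of_mem_convexHull
    (by rintro _ ⟨y, w, rfl, -, -, hy⟩ j; exact pow_le_pow_right₀ hd'.le (hy j).1) hq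
  refine hhit ⟨q, hqN, fun j => ⟨hqp j, ?_⟩⟩
  refine le_of_mul_le_mul_left ?_ hd0
  calc (d : ℝ) * d ^ p j = d ^ (p j + 1) := (pow_succ' _ _).symm
    _ ≤ d ^ (w j + y j) := pow_le_pow_right₀ hd'.le (by have := (hy j).2; omega)
    _ = d ^ w j * d ^ y j := pow_add _ _ _
    _ ≤ d ^ w j * (d * q j) := by gcongr; exact hxq j
    _ = d * (d ^ w j * q j) := by ring

open Classical in
theorem card_exponents_le {b : ℝ} (hb : 1 < b) (s : Finset ℕ) (w : ℕ) (x : ℝ) :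
    (s.filter fun i => x ≤ b ^ i ∧ b ^ i ≤ b ^ w * x).card ≤ w + 1 := by
  set t := s.filter fun i => x ≤ b ^ i ∧ b ^ i ≤ b ^ w * x with ht
  rcases t.eq_empty_or_nonempty with h | h
  · simp [h]
  · have hsub : t ⊆ Finset.Icc (t.min' h) (t.min' h + w) := by
      intro i hi
      refine Finset.mem_Icc.2 ⟨t.min'_le i hi, ?_⟩
      have hmin := (Finset.mem_filter.1 (t.min'_mem h)).2.1
      have hi' := (Finset.mem_filter.1 hi).2.2
      rw [← pow_le_pow_iff_right₀ hb, add_comm, pow_add]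
      exact hi'.trans (by gcongr)
    refine (Finset.card_le_card hsub).trans ?_
    simp; omega

open Classical in
theorem card_boxHits_le {d : ℕ} (hd : 2 ≤ d) (N : Finset (Fin d → ℝ)) (s : Finset ℕ)
    (w : Fin d → ℕ) :
    ((Fintype.piFinset fun _ : Fin d => s).filter fun p => BoxHits N p w).card ≤
      N.card * ∏ j, (w j + 1) := by
  have hd' : (1 : ℝ) < d := by exact_mod_cast hd
  have hsub : (Fintype.piFinset fun _ : Fin d => s).filter (fun p => BoxHits N p w) ⊆
      N.biUnion fun q => Fintype.piFinset fun j =>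
        s.filter fun i => q j ≤ (d : ℝ) ^ i ∧ (d : ℝ) ^ i ≤ (d : ℝ) ^ w j * q j := by
    intro p hp
    obtain ⟨hp, q, hq, h⟩ := Finset.mem_filter.1 hp
    exact Finset.mem_biUnion.2 ⟨q, hq, Fintype.mem_piFinset.2 fun j =>
      Finset.mem_filter.2 ⟨Fintype.mem_piFinset.1 hp j, h j⟩⟩
  refine (Finset.card_le_card hsub).trans (Finset.card_biUnion_le_card_mul _ _ _ fun q _ => ?_)
  rw [Fintype.card_piFinset]
  exact Finset.prod_le_prod' fun j _ => card_exponents_le hd' _ _ _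

theorem prod_two_pow_sub_mul {d k m : ℕ} {c : Fin d → ℕ} (hc : ∑ j, c j = k) (hkm : k ≤ m) :
    (∏ j, 2 ^ (m - c j)) * 2 ^ k = (2 ^ m) ^ d := by
  rw [← hc, ← Finset.prod_pow_eq_pow_sum, ← Finset.prod_mul_distrib]
  have hle : ∀ j, c j ≤ m := fun j =>
    (Finset.single_le_sum (fun i _ => Nat.zero_le (c i)) (Finset.mem_univ j)).trans (hc.le.trans hkm)
  rw [Finset.prod_congr rfl fun j _ => by rw [← pow_add, Nat.sub_add_cancel (hle j)]]
  simp

open Classical in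
/-- Some corner `p` has the property that at least half of the boxes are not hit by `N`. -/
theorem exists_corner {d k : ℕ} (hd : 2 ≤ d) (N : Finset (Fin d → ℝ))
    (hN : N.card * 2 ^ (d + 1) ≤ 2 ^ k) (A : Finset (Fin d → ℕ)) (hA : ∀ c ∈ A, ∑ j, c j = k) :
    ∃ p : Fin d → ℕ, (∀ j, p j ∈ Finset.Ico (2 ^ (k + 1)) (2 ^ (k + 2))) ∧
      A.card ≤ 2 * (A.filter fun c => ¬ BoxHits N p fun j => 2 ^ (k + 1 - c j)).card := by
  set s := Finset.Ico (2 ^ (k + 1)) (2 ^ (k + 2)) with hs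
  have hscard : s.card = 2 ^ (k + 1) := by
    rw [hs, Nat.card_Ico, pow_succ 2 (k + 1)]; omega
  set P := Fintype.piFinset fun _ : Fin d => s with hP
  have hPcard : P.card = (2 ^ (k + 1)) ^ d := by
    rw [hP, Fintype.card_piFinset]; simp [hscard]
  have hPne : P.Nonempty := by
    rw [← Finset.card_pos, hPcard]; positivity
  have hbad : ∀ c ∈ A,
      2 * (P.filter fun p => BoxHits N p fun j => 2 ^ (k + 1 - c j)).card ≤ P.card := by
    intro c hc
    have h1 := card_boxHits_le hd N s fun j => 2 ^ (k + 1 - c j)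
    have hle : ∀ j, c j ≤ k := fun j =>
      (Finset.single_le_sum (fun i _ => Nat.zero_le (c i)) (Finset.mem_univ j)).trans (hA c hc).le
    have h2 : ∏ j, (2 ^ (k + 1 - c j) + 1) ≤ ∏ j, 2 ^ (k + 2 - c j) := by
      refine Finset.prod_le_prod' fun j _ => ?_
      have : k + 2 - c j = (k + 1 - c j) + 1 := by have := hle j; omega
      rw [this, pow_succ]
      have := Nat.one_le_two_pow (n := k + 1 - c j)
      omega
    have h3 := prod_two_pow_sub_mul (m := k + 2) (hA c hc) (by omega)
    set Q := ∏ j, 2 ^ (k + 2 - c j)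
    refine Nat.le_of_mul_le_mul_right ?_ (show 0 < 2 ^ d * 2 ^ k by positivity)
    calc _ ≤ 2 * (N.card * Q) * (2 ^ d * 2 ^ k) := by gcongr; exact h1.trans (by gcongr)
      _ = (N.card * 2 ^ (d + 1)) * (Q * 2 ^ k) := by ring
      _ ≤ 2 ^ k * (2 ^ (k + 2)) ^ d := by rw [h3]; gcongr
      _ = P.card * (2 ^ d * 2 ^ k) := by
        rw [hPcard, show (2 : ℕ) ^ (k + 2) = 2 ^ (k + 1) * 2 from pow_succ _ _, mul_pow]; ring
  have hsum : ∑ p ∈ P, 2 * (A.filter fun c => BoxHits N p fun j => 2 ^ (k + 1 - c j)).card ≤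
      ∑ _p ∈ P, A.card := by
    rw [← Finset.mul_sum]
    have hcomm := Finset.sum_card_bipartiteAbove_eq_sum_card_bipartiteBelow
      (s := P) (t := A) fun p c => BoxHits N p fun j => 2 ^ (k + 1 - c j)
    simp only [Finset.bipartiteAbove, Finset.bipartiteBelow] at hcomm
    rw [hcomm, Finset.mul_sum]
    refine (Finset.sum_le_sum hbad).trans ?_
    simp [mul_comm]
  obtain ⟨p, hpP, hp⟩ := Finset.exists_le_of_sum_le hPne hsum
  refine ⟨p, fun j => Fintype.mem_piFinset.1 hpP j, ?_⟩
  have := Finset.card_filter_add_card_filter_not (s := A)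
    fun c => BoxHits N p fun j => 2 ^ (k + 1 - c j)
  omega

/-- The part of the box with upper corner `p` and side lengths `2 ^ (k + 1 - c j)` that is far
from `p` in every coordinate. -/
def farCell {d : ℕ} (k : ℕ) (p c : Fin d → ℕ) : Finset (Fin d → ℕ) :=
  Fintype.piFinset fun j => Finset.Ioc (p j - 2 ^ (k + 1 - c j)) (p j - 2 ^ (k - c j))

theorem mem_farCell {d k : ℕ} {p c y : Fin d → ℕ} (hp : ∀ j, 2 ^ (k + 1) ≤ p j) :
    y ∈ farCell k p c ↔ ∀ j, p j < y j + 2 ^ (k + 1 - c j) ∧ y j + 2 ^ (k - c j) ≤ p j := by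
  simp only [farCell, Fintype.mem_piFinset, Finset.mem_Ioc]
  refine forall_congr' fun j => ?_
  have h1 : 2 ^ (k + 1 - c j) ≤ 2 ^ (k + 1) := Nat.pow_le_pow_right two_pos (by omega)
  have h2 : 2 ^ (k - c j) ≤ 2 ^ (k + 1) := Nat.pow_le_pow_right two_pos (by omega)
  have := hp j
  omega

theorem card_farCell {d k : ℕ} {p c : Fin d → ℕ} (hp : ∀ j, 2 ^ (k + 1) ≤ p j)
    (hc : ∀ j, c j ≤ k) : (farCell k p c).card = ∏ j, 2 ^ (k - c j) := by
  rw [farCell, Fintype.card_piFinset]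
  refine Finset.prod_congr rfl fun j _ => ?_
  have h1 : 2 ^ (k + 1 - c j) ≤ 2 ^ (k + 1) := Nat.pow_le_pow_right two_pos (by omega)
  have h2 : k + 1 - c j = (k - c j) + 1 := by have := hc j; omega
  have := hp j
  rw [Nat.card_Ioc]
  rw [h2, pow_succ] at h1 ⊢
  omega

theorem le_of_mem_farCell {d k : ℕ} {p c c' y : Fin d → ℕ} (hp : ∀ j, 2 ^ (k + 1) ≤ p j)
    (hy : y ∈ farCell k p c) (hy' : y ∈ farCell k p c') (j : Fin d) : c j ≤ c' j ∨ k < c j := by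
  by_contra! h
  have h1 := ((mem_farCell hp).1 hy j).1
  have h2 := ((mem_farCell hp).1 hy' j).2
  have h3 : 2 ^ (k + 1 - c j) ≤ 2 ^ (k - c' j) := Nat.pow_le_pow_right two_pos (by omega)
  omega

open Classical in
/-- If `N` is small, then some convex set avoiding `N` contains many points of the stretched
grid. -/
theorem exists_convex_disjoint {d k : ℕ} (hd : 2 ≤ d) (N : Finset (Fin d → ℝ))
    (hN : N.card * 2 ^ (d + 1) ≤ 2 ^ k) (A : Finset (Fin d → ℕ)) (hA : ∀ c ∈ A, ∑ j, c j = k) :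
    ∃ C : Set (Fin d → ℝ), Convex ℝ C ∧ Disjoint (↑N : Set (Fin d → ℝ)) C ∧
      A.card * (stretchedGrid d (2 ^ (k + 2))).card ≤
        2 ^ (k + 2 * d + 1) * ((stretchedGrid d (2 ^ (k + 2))).filter fun x => x ∈ C).card := by
  obtain ⟨p, hp, hcard⟩ := exists_corner hd N hN A hA
  have hple : ∀ j, 2 ^ (k + 1) ≤ p j := fun j => (Finset.mem_Ico.1 (hp j)).1
  have hle : ∀ c ∈ A, ∀ j, c j ≤ k := fun c hc j =>
    (Finset.single_le_sum (fun i _ => Nat.zero_le (c i)) (Finset.mem_univ j)).trans (hA c hc).le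
  set G := A.filter fun c => ¬ BoxHits N p fun j => 2 ^ (k + 1 - c j) with hG
  have hGA : ∀ c ∈ G, c ∈ A := fun c hc => (Finset.mem_filter.1 hc).1
  let W : Set (Fin d → ℕ) := {w | ∃ c ∈ A, w = fun j => 2 ^ (k + 1 - c j)}
  refine ⟨_, convex_convexHull ℝ _, disjoint_convexHull_unhitCorner hd N W p, ?_⟩
  set F := (stretchedGrid d (2 ^ (k + 2))).filter
    fun x => x ∈ convexHull ℝ (unhitCorner N W p) with hF
  have hsub : (G.biUnion fun c => farCell k p c).image stretch ⊆ F := by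
    intro x hx
    obtain ⟨y, hy, rfl⟩ := Finset.mem_image.1 hx
    obtain ⟨c, hc, hyc⟩ := Finset.mem_biUnion.1 hy
    rw [mem_farCell hple] at hyc
    refine Finset.mem_filter.2 ⟨Finset.mem_image_of_mem _ (Fintype.mem_piFinset.2 fun j => ?_),
      subset_convexHull ℝ _ ⟨y, _, rfl, ⟨c, hGA c hc, rfl⟩, (Finset.mem_filter.1 hc).2,
        fun j => ⟨le_of_add_le_left (hyc j).2, (hyc j).1⟩⟩⟩
    exact Finset.mem_range.2 ((le_of_add_le_left (hyc j).2).trans_lt (Finset.mem_Ico.1 (hp j)).2)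
  have hdisj : (G : Set (Fin d → ℕ)).PairwiseDisjoint fun c => farCell k p c := by
    intro c hc c' hc' hne
    refine Finset.disjoint_left.2 fun y hy hy' => hne (funext fun j => ?_)
    have h1 := le_of_mem_farCell hple hy hy' j
    have h2 := le_of_mem_farCell hple hy' hy j
    have := hle c (hGA c hc) j
    have := hle c' (hGA c' hc') j
    omega
  have hFcard := Finset.card_le_card hsub
  rw [Finset.card_image_of_injective _ (stretch_injective hd), Finset.card_biUnion hdisj] at hFcard
  have hcells : ∑ c ∈ G, (farCell k p c).card * 2 ^ k = G.card * (2 ^ k) ^ d := by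
    rw [Finset.sum_congr rfl fun c hc => by
      rw [card_farCell hple (hle c (hGA c hc)), prod_two_pow_sub_mul (hA c (hGA c hc)) le_rfl]]
    simp
  rw [← Finset.sum_mul] at hcells
  rw [card_stretchedGrid hd]
  calc A.card * (2 ^ (k + 2)) ^ d ≤ 2 * G.card * (2 ^ (k + 2)) ^ d := by gcongr
    _ = 2 ^ (2 * d + 1) * (G.card * (2 ^ k) ^ d) := by
      rw [pow_add 2 k 2, mul_pow, ← pow_mul 2 2 d]; ring
    _ ≤ 2 ^ (2 * d + 1) * (F.card * 2 ^ k) := by rw [← hcells]; gcongr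
    _ = 2 ^ (k + 2 * d + 1) * F.card := by ring

/-- There are at least `(s + 1) ^ e` tuples of `e + 1` natural numbers with sum `e * s`. -/
theorem exists_tuples_sum_eq (e s : ℕ) :
    ∃ A : Finset (Fin (e + 1) → ℕ), A.card = (s + 1) ^ e ∧ ∀ c ∈ A, ∑ j, c j = e * s := by
  let T := Fintype.piFinset fun _ : Fin e => Finset.range (s + 1)
  let g : (Fin e → ℕ) → Fin (e + 1) → ℕ := fun f => Fin.cons (e * s - ∑ i, f i) f
  have hg : Function.Injective g := fun f f' h => (Fin.cons_inj.1 h).2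
  refine ⟨T.map ⟨g, hg⟩, by simp [T], fun c hc => ?_⟩
  obtain ⟨f, hf, rfl⟩ := Finset.mem_map.1 hc
  have hle : ∑ i, f i ≤ e * s := by
    refine (Finset.sum_le_card_nsmul _ _ s fun i _ => ?_).trans (by simp)
    have := Finset.mem_range.1 (Fintype.mem_piFinset.1 hf i)
    omega
  simp [g, Fin.sum_univ_succ, Nat.sub_add_cancel hle]

theorem two_pow_lt_card_mul_of_isWeakNet {e s : ℕ} (he : 1 ≤ e) {r : ℝ} (hr : 0 < r)
    (hrs : (2 : ℝ) ^ (e * s + 2 * (e + 1) + 1) ≤ r * (s + 1) ^ e) {N : Finset (Fin (e + 1) → ℝ)}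
    (hN : IsWeakNet (stretchedGrid (e + 1) (2 ^ (e * s + 2))) (1 / r)
      (↑N : Set (Fin (e + 1) → ℝ))) :
    2 ^ (e * s) < N.card * 2 ^ (e + 2) := by
  by_contra! h
  obtain ⟨A, hAcard, hA⟩ := exists_tuples_sum_eq e s
  obtain ⟨C, hC, hdisj, hcard⟩ := exists_convex_disjoint (by omega) N h A hA
  refine (hN C hC ?_).ne_empty hdisj.inter_eq
  rw [one_div, inv_mul_le_iff₀ hr]
  rw [hAcard] at hcard
  refine le_of_mul_le_mul_left ?_ (show (0 : ℝ) < (s + 1) ^ e by positivity)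
  have hcard' := (Nat.cast_le (α := ℝ)).2 hcard
  push_cast at hcard'
  refine hcard'.trans ((mul_le_mul_of_nonneg_right hrs (Nat.cast_nonneg _)).trans_eq ?_)
  ring

theorem IsWeakNet.nonempty {d : ℕ} {X : Finset (Fin d → ℝ)} {ε : ℝ} (hε : ε ≤ 1)
    {N : Set (Fin d → ℝ)} (hN : IsWeakNet X ε N) : N.Nonempty := by
  refine (hN Set.univ convex_univ ?_).mono Set.inter_subset_left
  simpa using mul_le_mul_of_nonneg_right hε (Nat.cast_nonneg (α := ℝ) X.card)

theorem add_one_sq_le_four_mul_two_pow (s : ℕ) : (s + 1) ^ 2 ≤ 4 * 2 ^ s := by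
  induction s with
  | zero => norm_num
  | succ n ih =>
    rcases Nat.lt_or_ge n 2 with h | h
    · interval_cases n <;> norm_num
    · rw [pow_succ 2 n]
      nlinarith

theorem exists_mul_pow_lt_two_pow {e : ℕ} (he : 1 ≤ e) {r : ℝ} (hr : 2 ≤ r) (a : ℕ) :
    ∃ s : ℕ, r * (s + 1) ^ e < (2 : ℝ) ^ (e * s + a + 1) := by
  obtain ⟨s, hs⟩ := exists_nat_ge (4 * r)
  refine ⟨s, ?_⟩
  have h1 : ((s : ℝ) + 1) ^ 2 ≤ 4 * 2 ^ s := by exact_mod_cast add_one_sq_le_four_mul_two_pow s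
  have h2 : r * (s + 1) ≤ 2 ^ s := by nlinarith
  calc r * (s + 1) ^ e ≤ r ^ e * (s + 1) ^ e := by
        gcongr; exact le_self_pow₀ (by linarith) (by omega)
    _ = (r * (s + 1)) ^ e := (mul_pow _ _ _).symm
    _ ≤ (2 ^ s) ^ e := by gcongr
    _ = 2 ^ (e * s) := by rw [← pow_mul, mul_comm]
    _ < 2 ^ (e * s + a + 1) := pow_lt_pow_right₀ (by norm_num) (by omega)

theorem log_le_of_le_two_pow {r : ℝ} (hr : 0 < r) {m : ℕ} (h : r ≤ 2 ^ m) : Real.log r ≤ m := by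
  calc Real.log r ≤ Real.log (2 ^ m) := Real.log_le_log hr h
    _ = m * Real.log 2 := Real.log_pow _ _
    _ ≤ m * 1 := by gcongr; linarith [Real.log_two_lt_d9]
    _ = m := mul_one _

/-- For every `d ≥ 2` there is `c > 0` such that for every `r ≥ 2` there is a finite
set `X ⊂ ℝ^d` for which every weak `1/r`-net has at least `c · r · (log r)^(d-1)` points. -/
theorem weak_epsilon_net_lower_bound (d : ℕ) (hd : 2 ≤ d) :
    ∃ c : ℝ, 0 < c ∧ ∀ r : ℝ, 2 ≤ r →
      ∃ X : Finset (Fin d → ℝ), X.Nonempty ∧ ∀ N : Finset (Fin d → ℝ),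
        IsWeakNet X (1 / r) (↑N : Set (Fin d → ℝ)) →
          c * r * (Real.log r) ^ (d - 1) ≤ (N.card : ℝ) := by
  obtain ⟨e, rfl⟩ : ∃ e, d = e + 1 := ⟨d - 1, by omega⟩
  have he : 1 ≤ e := by omega
  set b := 2 * (e + 1) + 1 with hb
  have hb0 : (0 : ℝ) < b := by positivity
  set c : ℝ := ((2 : ℝ) ^ (b + 2 * e + 2) * (b : ℝ) ^ e)⁻¹ with hc
  refine ⟨c, by positivity, fun r hr => ?_⟩
  have hr0 : 0 < r := by linarith
  have hlog : 0 ≤ Real.log r := Real.log_nonneg (by linarith)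
  have hne : ∀ m, (stretchedGrid (e + 1) (2 ^ m)).Nonempty := fun m => by
    rw [← Finset.card_pos, card_stretchedGrid hd]; positivity
  rw [Nat.add_sub_cancel]
  rcases lt_or_ge r ((2 : ℝ) ^ b) with hrb | hrb
  · refine ⟨_, hne 0, fun N hN => ?_⟩
    have hcard : (1 : ℝ) ≤ N.card := by
      exact_mod_cast (Finset.coe_nonempty.1 (hN.nonempty (by
        rw [div_le_one hr0]; linarith))).card_pos
    refine le_trans ?_ hcard
    rw [hc, mul_assoc, inv_mul_le_iff₀ (by positivity), mul_one]
    have hlb : Real.log r ≤ b := log_le_of_le_two_pow hr0 hrb.le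
    have hpow : (2 : ℝ) ^ b ≤ 2 ^ (b + 2 * e + 2) := pow_le_pow_right₀ (by norm_num) (by omega)
    gcongr
    exact hrb.le.trans hpow
  · classical
    have hex := exists_mul_pow_lt_two_pow he hr (2 * (e + 1))
    have hspec := Nat.find_spec hex
    have hpos : Nat.find hex ≠ 0 := by
      intro h0
      rw [h0] at hspec
      simp only [Nat.cast_zero, zero_add, one_pow, mul_one, mul_zero] at hspec
      linarith
    obtain ⟨s, hs⟩ := Nat.exists_eq_succ_of_ne_zero hpos
    have hmin := not_lt.1 (Nat.find_min hex (m := s) (by omega))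
    rw [hs] at hspec
    refine ⟨_, hne (e * s + 2), fun N hN => ?_⟩
    have hcard : (2 : ℝ) ^ (e * s) < N.card * 2 ^ (e + 2) := by
      exact_mod_cast two_pow_lt_card_mul_of_isWeakNet he hr0 hmin hN
    set t : ℝ := ((s.succ : ℕ) : ℝ) + 1 with ht
    have ht1 : 1 ≤ t := by rw [ht]; linarith [Nat.cast_nonneg (α := ℝ) s.succ]
    have hlt : Real.log r ≤ b * t := by
      have h1 : r ≤ 2 ^ (e * s.succ + 2 * (e + 1) + 1) :=
        (le_mul_of_one_le_right hr0.le (one_le_pow₀ ht1)).trans hspec.le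
      refine (log_le_of_le_two_pow hr0 h1).trans ?_
      rw [ht, hb]
      push_cast
      nlinarith [Nat.cast_nonneg (α := ℝ) s, Nat.cast_nonneg (α := ℝ) e,
        mul_nonneg (Nat.cast_nonneg (α := ℝ) s) (Nat.cast_nonneg (α := ℝ) e)]
    rw [hc, mul_assoc, inv_mul_le_iff₀ (by positivity)]
    calc r * Real.log r ^ e ≤ r * (b * t) ^ e := by gcongr
      _ = (b : ℝ) ^ e * (r * t ^ e) := by rw [mul_pow]; ring
      _ ≤ (b : ℝ) ^ e * 2 ^ (e * s.succ + 2 * (e + 1) + 1) := by gcongr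
      _ = (b : ℝ) ^ e * 2 ^ (b + e) * 2 ^ (e * s) := by
        rw [mul_assoc, ← pow_add, hb]; congr 2; rw [Nat.mul_succ]; ring
      _ ≤ (b : ℝ) ^ e * 2 ^ (b + e) * (N.card * 2 ^ (e + 2)) := by gcongr
      _ = 2 ^ (b + 2 * e + 2) * (b : ℝ) ^ e * N.card := by ring
end

section
/- For every integer d ≥ 1 there exists a constant c > 0 (depending only on d) such that for every real r ≥ 2, every (1/r)-net N for [0,1]^d with respect to stair-convex sets satisfies |N| ≥ c · r · (log r)^{d−1}. -/
noncomputable def stairPath : (d : ℕ) → (Fin d → ℝ) → (Fin d → ℝ) → Set (Fin d → ℝ)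
  | 0, _, _ => Set.univ
  | (d+1), a, b =>
    if a (Fin.last d) ≤ b (Fin.last d) then
      segment ℝ a (Fin.snoc (Fin.init a) (b (Fin.last d))) ∪
        (fun z => Fin.snoc z (b (Fin.last d))) '' stairPath d (Fin.init a) (Fin.init b)
    else
      segment ℝ b (Fin.snoc (Fin.init b) (a (Fin.last d))) ∪
        (fun z => Fin.snoc z (a (Fin.last d))) '' stairPath d (Fin.init b) (Fin.init a)

def StairConvex {d : ℕ} (S : Set (Fin d → ℝ)) : Prop :=
  ∀ a ∈ S, ∀ b ∈ S, stairPath d a b ⊆ S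

/-- The unit cube `[0,1]^d`. -/
def unitCube (d : ℕ) : Set (Fin d → ℝ) := Set.Icc 0 1

/-- `N ⊆ [0,1]^d` is an `ε`-net for `[0,1]^d` with respect to stair-convex sets:
`N` intersects every stair-convex `S ⊆ [0,1]^d` of Lebesgue measure at least `ε`. -/
def IsStairNet (d : ℕ) (ε : ℝ) (N : Set (Fin d → ℝ)) : Prop :=
  N ⊆ unitCube d ∧
    ∀ S : Set (Fin d → ℝ), S ⊆ unitCube d → StairConvex S →
      ENNReal.ofReal ε ≤ MeasureTheory.volume S → (N ∩ S).Nonempty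

open MeasureTheory Set

theorem le_or_le_of_mem_stairPath {d : ℕ} {a b z : Fin d → ℝ} (hz : z ∈ stairPath d a b) :
    (a ≤ z ∨ b ≤ z) ∧ z ≤ a ⊔ b := by
  induction d with
  | zero => exact ⟨Or.inl (fun i => i.elim0), fun i => i.elim0⟩
  | succ d ih =>
    have key : ∀ {a b : Fin (d + 1) → ℝ}, a (Fin.last d) ≤ b (Fin.last d) →
        z ∈ segment ℝ a (Fin.snoc (Fin.init a) (b (Fin.last d)) : Fin (d + 1) → ℝ) ∪
          (fun z => (Fin.snoc z (b (Fin.last d)) : Fin (d + 1) → ℝ)) ''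
            stairPath d (Fin.init a) (Fin.init b) →
        (a ≤ z ∨ b ≤ z) ∧ z ≤ a ⊔ b := by
      intro a b hab hz
      rcases hz with hz | ⟨y, hy, rfl⟩
      · have hle : a ≤ (Fin.snoc (Fin.init a) (b (Fin.last d)) : Fin (d + 1) → ℝ) := by
          intro i
          refine Fin.lastCases ?_ (fun j => ?_) i
          · simpa using hab
          · simp [Fin.init]
        have hmem := segment_subset_Icc hle hz
        refine ⟨Or.inl hmem.1, hmem.2.trans fun i => ?_⟩
        refine Fin.lastCases ?_ (fun j => ?_) i
        · simp
        · simp [Fin.init]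
      · obtain ⟨h₁, h₂⟩ := ih hy
        refine ⟨h₁.imp (fun h i => ?_) (fun h i => ?_), fun i => ?_⟩
        · refine Fin.lastCases ?_ (fun j => ?_) i
          · simpa using hab
          · simpa [Fin.init] using h j
        · refine Fin.lastCases ?_ (fun j => ?_) i
          · simp
          · simpa [Fin.init] using h j
        · refine Fin.lastCases ?_ (fun j => ?_) i
          · simp
          · simpa [Fin.init] using h₂ j
    unfold stairPath at hz
    split_ifs at hz with hab
    · exact key hab hz
    · have := key (not_le.mp hab).le hz
      rwa [or_comm, sup_comm] at this

/-- The points below `q` in the unit cube that span with `q` a box free of points of `N`. -/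
def emptyCornerSet {d : ℕ} (N : Set (Fin d → ℝ)) (q : Fin d → ℝ) : Set (Fin d → ℝ) :=
  {x | 0 ≤ x ∧ x ≤ q ∧ ∀ p ∈ N, ¬ (x ≤ p ∧ p ≤ q)}

theorem stairConvex_emptyCornerSet {d : ℕ} (N : Set (Fin d → ℝ)) (q : Fin d → ℝ) :
    StairConvex (emptyCornerSet N q) := by
  rintro a ⟨ha₀, haq, ha⟩ b ⟨hb₀, hbq, hb⟩ z hz
  obtain ⟨h, hz'⟩ := le_or_le_of_mem_stairPath hz
  refine ⟨?_, hz'.trans (sup_le haq hbq), fun p hp hpz => ?_⟩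
  · rcases h with h | h
    · exact ha₀.trans h
    · exact hb₀.trans h
  · rcases h with h | h
    · exact ha p hp ⟨h.trans hpz.1, hpz.2⟩
    · exact hb p hp ⟨h.trans hpz.1, hpz.2⟩

theorem IsStairNet.volume_emptyCornerSet_lt {d : ℕ} {ε : ℝ} {N : Set (Fin d → ℝ)}
    (hN : IsStairNet d ε N) {q : Fin d → ℝ} (hq : q ≤ 1) :
    volume (emptyCornerSet N q) < ENNReal.ofReal ε := by
  by_contra! h
  obtain ⟨p, hpN, hp⟩ := hN.2 _ (fun x hx => ⟨hx.1, hx.2.1.trans hq⟩)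
    (stairConvex_emptyCornerSet N q) h
  exact hp.2.2 p hpN ⟨le_rfl, hp.2.1⟩

/-- The part of the cube `[0,1/2]^d` where the product of the coordinates is at most `δ`. -/
def hyperbolicRegion (d : ℕ) (δ : ℝ) : Set (Fin d → ℝ) :=
  {s | s ∈ Icc (0 : Fin d → ℝ) (fun _ => 1 / 2) ∧ ∏ i, s i ≤ δ}

theorem measurableSet_hyperbolicRegion (d : ℕ) (δ : ℝ) :
    MeasurableSet (hyperbolicRegion d δ) :=
  have hclosed : IsClosed {s : Fin d → ℝ | ∏ i, s i ≤ δ} :=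
    isClosed_le (by fun_prop) continuous_const
  (isClosed_Icc.inter hclosed).measurableSet

theorem integral_log_div_pow_div {a b : ℝ} (ha : 0 < a) (hab : a ≤ b) (k : ℕ) :
    ∫ t in a..b, Real.log (t / a) ^ k / t = Real.log (b / a) ^ (k + 1) / (k + 1) := by
  have hne : ∀ t ∈ uIcc a b, t ≠ 0 := fun t ht => by
    rw [uIcc_of_le hab] at ht
    exact (ha.trans_le ht.1).ne'
  have hderiv : ∀ t ∈ uIcc a b,
      HasDerivAt (fun t => Real.log (t / a) ^ (k + 1) / (k + 1)) (Real.log (t / a) ^ k / t) t := by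
    intro t ht
    have ht0 := hne t ht
    have h₁ : HasDerivAt (fun t => Real.log (t / a)) ((1 / a) / (t / a)) t :=
      ((hasDerivAt_id t).div_const a).log (div_ne_zero ht0 ha.ne')
    have h₂ := (h₁.pow (k + 1)).div_const ((k : ℝ) + 1)
    refine h₂.congr_deriv ?_
    have : (k : ℝ) + 1 ≠ 0 := by positivity
    push_cast
    field_simp
  rw [intervalIntegral.integral_eq_sub_of_hasDerivAt hderiv]
  · simp [ha.ne']
  · refine ContinuousOn.intervalIntegrable fun t ht => ContinuousAt.continuousWithinAt ?_
    have ht0 := hne t ht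
    have : t / a ≠ 0 := div_ne_zero ht0 ha.ne'
    fun_prop (disch := assumption)

theorem le_volume_hyperbolicRegion (k : ℕ) {δ : ℝ} (hδ : 0 < δ) (hδ' : 2 ^ (k + 1) * δ ≤ 1) :
    ENNReal.ofReal (δ * Real.log (1 / (2 ^ (k + 1) * δ)) ^ k / k.factorial) ≤
      volume (hyperbolicRegion (k + 1) δ) := by
  induction k generalizing δ with
  | zero =>
    have : Icc (0 : Fin 1 → ℝ) (fun _ => δ) ⊆ hyperbolicRegion (0 + 1) δ := by
      intro s hs
      refine ⟨⟨hs.1, fun i => (hs.2 i).trans ?_⟩, ?_⟩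
      · simp only [zero_add, pow_one] at hδ'
        linarith
      · simpa using hs.2 0
    refine le_trans ?_ (measure_mono this)
    rw [Real.volume_Icc_pi]
    simp
  | succ k ih =>
    set a : ℝ := 2 ^ (k + 1) * δ with ha
    have ha0 : 0 < a := by positivity
    have hab : a ≤ 1 / 2 := by
      rw [pow_succ] at hδ'
      linarith
    have hslice : volume (hyperbolicRegion (k + 1 + 1) δ) =
        ∫⁻ t : ℝ, volume {s : Fin (k + 1) → ℝ |
          (Fin.cons t s : Fin (k + 1 + 1) → ℝ) ∈ hyperbolicRegion (k + 1 + 1) δ} := by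
      have hmp := (volume_preserving_piFinSuccAbove (fun _ : Fin (k + 1 + 1) => ℝ) 0).symm
      rw [← hmp.measure_preimage (measurableSet_hyperbolicRegion _ _).nullMeasurableSet,
        Measure.volume_eq_prod, Measure.prod_apply
          (hmp.measurable (measurableSet_hyperbolicRegion _ _))]
      refine lintegral_congr fun t => congrArg volume (Set.ext fun s => ?_)
      simp [MeasurableEquiv.piFinSuccAbove, Fin.consEquiv]
    have hle : ∀ t ∈ Ioc a (1 / 2 : ℝ),
        ENNReal.ofReal (δ / k.factorial * (Real.log (t / a) ^ k / t)) ≤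
          volume {s : Fin (k + 1) → ℝ |
            (Fin.cons t s : Fin (k + 1 + 1) → ℝ) ∈ hyperbolicRegion (k + 1 + 1) δ} := by
      intro t ht
      have ht0 : 0 < t := ha0.trans ht.1
      have hsub : hyperbolicRegion (k + 1) (δ / t) ⊆ {s : Fin (k + 1) → ℝ |
            (Fin.cons t s : Fin (k + 1 + 1) → ℝ) ∈ hyperbolicRegion (k + 1 + 1) δ} := by
        rintro s ⟨⟨h₀, h₁⟩, h₂⟩
        refine ⟨⟨fun i => ?_, fun i => ?_⟩, ?_⟩
        · refine Fin.cases ?_ (fun j => ?_) i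
          · simpa using ht0.le
          · simpa using h₀ j
        · refine Fin.cases ?_ (fun j => ?_) i
          · simpa using ht.2
          · simpa using h₁ j
        · rw [Fin.prod_cons, mul_comm]
          exact (le_div_iff₀ ht0).mp h₂
      refine le_trans (le_of_eq ?_) ((ih (div_pos hδ ht0) ?_).trans (measure_mono hsub))
      · have : 1 / (2 ^ (k + 1) * (δ / t)) = t / a := by
          rw [ha]
          field_simp
        rw [this]
        congr 1
        field_simp
      · rw [← mul_div_assoc, div_le_one ht0]
        exact ht.1.le
    have hcont : ContinuousOn (fun t => δ / k.factorial * (Real.log (t / a) ^ k / t))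
        (Icc a (1 / 2)) := by
      intro t ht
      refine ContinuousAt.continuousWithinAt ?_
      have ht0 : t ≠ 0 := (ha0.trans_le ht.1).ne'
      have : t / a ≠ 0 := div_ne_zero ht0 ha0.ne'
      fun_prop (disch := assumption)
    calc ENNReal.ofReal
          (δ * Real.log (1 / (2 ^ (k + 1 + 1) * δ)) ^ (k + 1) / (k + 1).factorial)
        = ENNReal.ofReal (∫ t in a..(1 / 2), δ / k.factorial * (Real.log (t / a) ^ k / t)) := by
          rw [intervalIntegral.integral_const_mul, integral_log_div_pow_div ha0 hab]
          have : 1 / (2 ^ (k + 1 + 1) * δ) = 1 / 2 / a := by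
            rw [ha, pow_succ]
            field_simp
          rw [this, Nat.factorial_succ]
          push_cast
          congr 1
          field_simp
      _ = ∫⁻ t in Ioc a (1 / 2), ENNReal.ofReal (δ / k.factorial * (Real.log (t / a) ^ k / t)) := by
          rw [intervalIntegral.integral_of_le hab, ofReal_integral_eq_lintegral_ofReal]
          · exact (hcont.integrableOn_Icc).mono_set Ioc_subset_Icc_self
          · refine (ae_restrict_iff' measurableSet_Ioc).mpr (ae_of_all _ fun t ht => ?_)
            have ht0 : 0 < t := ha0.trans ht.1
            have : 0 ≤ Real.log (t / a) := Real.log_nonneg ((one_le_div ha0).mpr ht.1.le)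
            simp only [Pi.zero_apply]
            positivity
      _ ≤ ∫⁻ t in Ioc a (1 / 2), volume {s : Fin (k + 1) → ℝ |
            (Fin.cons t s : Fin (k + 1 + 1) → ℝ) ∈ hyperbolicRegion (k + 1 + 1) δ} :=
          setLIntegral_mono' measurableSet_Ioc hle
      _ ≤ volume (hyperbolicRegion (k + 1 + 1) δ) := by
          rw [hslice]
          exact setLIntegral_le_lintegral _ _

/-- Averaging over the top corner `q ∈ [1/2,1]^d`: boxes `[q - s, q]` of small volume mostly
avoid the finite set `N`. -/
theorem IsStairNet.volume_hyperbolicRegion_le {d : ℕ} {ε δ : ℝ} {N : Finset (Fin d → ℝ)}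
    (hN : IsStairNet d ε (N : Set (Fin d → ℝ))) (hδ : 2 ^ (d + 1) * (N.card * δ) ≤ 1) :
    volume (hyperbolicRegion d δ) ≤ 2 * ENNReal.ofReal ε := by
  set H := hyperbolicRegion d δ with hH
  set Q : Set (Fin d → ℝ) := Icc (fun _ => 1 / 2) 1 with hQ
  have hHm : MeasurableSet H := measurableSet_hyperbolicRegion d δ
  have hvQ : volume Q = ENNReal.ofReal (1 / 2 ^ d) := by
    rw [hQ, Real.volume_Icc_pi]
    simp only [Pi.one_apply, Finset.prod_const, Finset.card_univ, Fintype.card_fin]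
    rw [← ENNReal.ofReal_pow (by norm_num)]
    congr 1
    rw [← one_div_pow]
    norm_num
  let G : Set ((Fin d → ℝ) × (Fin d → ℝ)) :=
    {z | ∀ p ∈ N, ¬ (z.1 - z.2 ≤ p ∧ p ≤ z.1)}
  have hGm : MeasurableSet G := by
    have : G = ⋂ p ∈ N, {z | z.1 - z.2 ≤ p ∧ p ≤ z.1}ᶜ := by
      ext z
      simp [G]
    rw [this]
    refine Finset.measurableSet_biInter _ fun p _ => MeasurableSet.compl (IsClosed.measurableSet ?_)
    have h₁ : IsClosed {z : (Fin d → ℝ) × (Fin d → ℝ) | z.1 - z.2 ≤ p} :=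
      isClosed_le (by fun_prop) continuous_const
    exact h₁.inter (isClosed_le continuous_const continuous_fst)
  have hfst : ∀ q ∈ Q, volume.restrict H (Prod.mk q ⁻¹' G) ≤ ENNReal.ofReal ε := by
    intro q hq
    rw [Measure.restrict_apply (measurable_prodMk_left hGm)]
    refine le_trans ?_ (hN.volume_emptyCornerSet_lt hq.2).le
    have hmp : MeasurePreserving (MeasurableEquiv.subLeft q) volume volume :=
      Measure.measurePreserving_sub_left volume q
    rw [← hmp.measure_preimage_equiv (emptyCornerSet (N : Set (Fin d → ℝ)) q)]
    refine measure_mono ?_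
    rintro s ⟨hs, hsH⟩
    change q - s ∈ emptyCornerSet (N : Set (Fin d → ℝ)) q
    exact ⟨sub_nonneg.mpr (hsH.1.2.trans hq.1), sub_le_self q hsH.1.1, hs⟩
  have hsnd : ∀ s ∈ H, ENNReal.ofReal (1 / 2 ^ (d + 1)) ≤
      volume.restrict Q ((fun q => (q, s)) ⁻¹' G) := by
    intro s hs
    rw [Measure.restrict_apply (measurable_prodMk_right hGm)]
    have hcover : Q ⊆ ((fun q => (q, s)) ⁻¹' G ∩ Q) ∪ ⋃ p ∈ N, Icc p (p + s) := by
      intro q hq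
      by_cases hqG : (q, s) ∈ G
      · exact Or.inl ⟨hqG, hq⟩
      · right
        simp only [G, mem_ofPred_eq, not_forall, not_not] at hqG
        obtain ⟨p, hp, h₁, h₂⟩ := hqG
        exact mem_biUnion hp ⟨h₂, sub_le_iff_le_add.mp h₁⟩
    have hbox : ∀ p : Fin d → ℝ, volume (Icc p (p + s)) ≤ ENNReal.ofReal δ := by
      intro p
      rw [Real.volume_Icc_pi]
      simp only [Pi.add_apply, add_sub_cancel_left]
      rw [← ENNReal.ofReal_prod_of_nonneg fun i _ => hs.1.1 i]
      exact ENNReal.ofReal_le_ofReal hs.2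
    have hδ0 : 0 ≤ δ := (Finset.prod_nonneg fun i _ => hs.1.1 i).trans hs.2
    have hun : volume (⋃ p ∈ N, Icc p (p + s)) ≤ ENNReal.ofReal (1 / 2 ^ (d + 1)) := by
      refine (measure_biUnion_finset_le _ _).trans ((Finset.sum_le_sum fun p _ => hbox p).trans ?_)
      rw [Finset.sum_const, nsmul_eq_mul, ← ENNReal.ofReal_natCast,
        ← ENNReal.ofReal_mul (by positivity)]
      refine ENNReal.ofReal_le_ofReal ?_
      rw [le_div_iff₀ (by positivity)]
      linarith
    have h := (measure_mono (μ := volume) hcover).trans (measure_union_le _ _)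
    rw [hvQ, show (1 : ℝ) / 2 ^ d = 1 / 2 ^ (d + 1) + 1 / 2 ^ (d + 1) by
      rw [pow_succ]; field_simp; norm_num, ENNReal.ofReal_add (by positivity) (by positivity)] at h
    exact (ENNReal.add_le_add_iff_right ENNReal.ofReal_ne_top).mp
      (h.trans (add_le_add_right hun _))
  have hmain : ENNReal.ofReal (1 / 2 ^ (d + 1)) * volume H ≤
      ENNReal.ofReal ε * ENNReal.ofReal (1 / 2 ^ d) := by
    calc ENNReal.ofReal (1 / 2 ^ (d + 1)) * volume H
        = ∫⁻ _ in H, ENNReal.ofReal (1 / 2 ^ (d + 1)) := by rw [setLIntegral_const]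
      _ ≤ ∫⁻ s in H, volume.restrict Q ((fun q => (q, s)) ⁻¹' G) :=
          setLIntegral_mono' hHm hsnd
      _ = ∫⁻ q in Q, volume.restrict H (Prod.mk q ⁻¹' G) := by
          rw [← Measure.prod_apply_symm hGm, Measure.prod_apply hGm]
      _ ≤ ∫⁻ _ in Q, ENNReal.ofReal ε := setLIntegral_mono' measurableSet_Icc hfst
      _ = _ := by rw [setLIntegral_const, hvQ]
  have htwo : ENNReal.ofReal (1 / 2 ^ d) = ENNReal.ofReal (1 / 2 ^ (d + 1)) * 2 := by
    rw [← ENNReal.ofReal_ofNat 2, ← ENNReal.ofReal_mul (by positivity), pow_succ]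
    congr 1
    field_simp
  rw [htwo, mul_left_comm, mul_comm _ 2] at hmain
  exact (ENNReal.mul_le_mul_iff_right (by simp) ENNReal.ofReal_ne_top).mp hmain

theorem IsStairNet.card_pos {d : ℕ} {r : ℝ} (hr : 2 ≤ r) {N : Finset (Fin d → ℝ)}
    (hN : IsStairNet d (1 / r) (N : Set (Fin d → ℝ))) : 0 < N.card := by
  by_contra! h
  have hempty : N = ∅ := by simpa using h
  subst hempty
  have h := hN.volume_emptyCornerSet_lt (q := 1) le_rfl
  have hset : emptyCornerSet ((∅ : Finset (Fin d → ℝ)) : Set (Fin d → ℝ)) 1 = Icc 0 1 := by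
    ext x
    simp [emptyCornerSet]
  rw [hset, Real.volume_Icc_pi] at h
  simp only [Pi.one_apply, Pi.zero_apply, sub_zero, ENNReal.ofReal_one, Finset.prod_const_one,
    ENNReal.one_lt_ofReal] at h
  rw [lt_div_iff₀ (by linarith)] at h
  linarith

theorem IsStairNet.mul_log_pow_le_card {k : ℕ} {r : ℝ} (hr : 2 ≤ r)
    {N : Finset (Fin (k + 1) → ℝ)}
    (hN : IsStairNet (k + 1) (1 / r) (N : Set (Fin (k + 1) → ℝ))) :
    1 / (2 ^ (k + 3) * k.factorial) * r * Real.log (2 * N.card) ^ k ≤ N.card := by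
  have hn : (0 : ℝ) < N.card := by exact_mod_cast hN.card_pos hr
  have hn1 : (1 : ℝ) ≤ N.card := by exact_mod_cast hN.card_pos hr
  have hr0 : 0 < r := by linarith
  set n : ℝ := (N.card : ℝ) with hn_def
  set δ : ℝ := 1 / (2 ^ (k + 2) * n) with hδ
  have hδ0 : 0 < δ := by positivity
  have hscale : 2 ^ (k + 1) * δ = 1 / (2 * n) := by
    rw [hδ, pow_succ _ (k + 1)]
    field_simp
  have hup := hN.volume_hyperbolicRegion_le (δ := δ) (by
    rw [← hn_def, hδ]
    apply le_of_eq
    field_simp)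
  have hlow := (le_volume_hyperbolicRegion k hδ0 (by
    rw [hscale, div_le_one (by positivity)]
    linarith)).trans hup
  rw [hscale, one_div_one_div, ← ENNReal.ofReal_ofNat 2, ← ENNReal.ofReal_mul (by norm_num),
    ENNReal.ofReal_le_ofReal_iff (by positivity), hδ] at hlow
  calc 1 / (2 ^ (k + 3) * k.factorial) * r * Real.log (2 * n) ^ k
      = (1 / (2 ^ (k + 2) * n) * Real.log (2 * n) ^ k / k.factorial) * (r * n / 2) := by
        rw [pow_succ _ (k + 2)]
        field_simp
    _ ≤ 2 * (1 / r) * (r * n / 2) := by gcongr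
    _ = n := by field_simp

/-- Every `1/r`-net for `[0,1]^d` with respect to stair-convex sets has at least
`c · r · (log r)^(d-1)` points. -/
theorem stair_convex_net_lower_bound (d : ℕ) (hd : 1 ≤ d) :
    ∃ c : ℝ, 0 < c ∧ ∀ r : ℝ, 2 ≤ r →
      ∀ N : Finset (Fin d → ℝ), IsStairNet d (1 / r) (↑N : Set (Fin d → ℝ)) →
        c * r * (Real.log r) ^ (d - 1) ≤ (N.card : ℝ) := by
  obtain ⟨k, rfl⟩ := Nat.exists_eq_add_of_le' hd
  have hlog2 : 0 < Real.log 2 := Real.log_pos one_lt_two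
  set A : ℝ := 1 / (2 ^ (k + 3) * k.factorial) with hA
  have hA0 : 0 < A := by positivity
  set B : ℝ := A * Real.log 2 ^ k with hB
  have hB0 : 0 < B := by positivity
  set M : ℝ := 1 + |Real.log (1 / (2 * B))| / Real.log 2 with hM
  have hM0 : 0 < M := by positivity
  refine ⟨A / M ^ k, by positivity, fun r hr N hN => ?_⟩
  have hn1 : (1 : ℝ) ≤ N.card := by exact_mod_cast hN.card_pos hr
  have hcard := hN.mul_log_pow_le_card hr
  rw [← hA] at hcard
  set n : ℝ := (N.card : ℝ)
  have hlog : Real.log 2 ≤ Real.log (2 * n) := Real.log_le_log two_pos (by linarith)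
  have hBn : B * r ≤ n := by
    refine le_trans ?_ hcard
    rw [hB, mul_right_comm]
    gcongr
  have hr_le : Real.log r ≤ M * Real.log (2 * n) := by
    have h₁ : r ≤ 2 * n * (1 / (2 * B)) := by
      rw [mul_one_div, le_div_iff₀ (by positivity)]
      linarith
    calc Real.log r ≤ Real.log (2 * n * (1 / (2 * B))) := Real.log_le_log (by linarith) h₁
      _ = Real.log (2 * n) + Real.log (1 / (2 * B)) :=
        Real.log_mul (by positivity) (by positivity)
      _ ≤ Real.log (2 * n) + |Real.log (1 / (2 * B))| / Real.log 2 * Real.log (2 * n) := by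
        gcongr
        rw [div_mul_eq_mul_div, le_div_iff₀ hlog2]
        exact mul_le_mul (le_abs_self _) hlog hlog2.le (abs_nonneg _)
      _ = M * Real.log (2 * n) := by rw [hM]; ring
  have hlogr : 0 ≤ Real.log r := Real.log_nonneg (by linarith)
  calc A / M ^ k * r * Real.log r ^ (k + 1 - 1)
      ≤ A / M ^ k * r * (M * Real.log (2 * n)) ^ k := by
        rw [Nat.add_sub_cancel]
        gcongr
    _ = A * r * Real.log (2 * n) ^ k := by
        rw [mul_pow]
        field_simp
    _ ≤ n := hcard
end

section
/- For every integer d ≥ 1 there exists a constant C > 0 (depending only on d) such that for every real r ≥ 2 there exists a set N ⊆ [0,1]^d with |N| ≤ C · r · (log r)^{d−1} that is a (1/r)-net for [0,1]^d with respect to stair-convex sets, i.e., N intersects every stair-convex set S ⊆ [0,1]^d of Lebesgue measure at least 1/r. -/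
open MeasureTheory

/-! ### Slices of stair-convex sets -/

namespace StairConvex

theorem snoc_init_mem {d : ℕ} {S : Set (Fin (d + 1) → ℝ)} (hS : StairConvex S)
    {a b : Fin (d + 1) → ℝ} (ha : a ∈ S) (hb : b ∈ S) {h : ℝ}
    (h₁ : a (Fin.last d) ≤ h) (h₂ : h ≤ b (Fin.last d)) :
    (Fin.snoc (Fin.init a) h : Fin (d + 1) → ℝ) ∈ S := by
  refine hS a ha b hb ?_
  rw [stairPath, if_pos (h₁.trans h₂)]
  left
  have hmem : h ∈ segment ℝ (a (Fin.last d)) (b (Fin.last d)) := by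
    rw [segment_eq_Icc (h₁.trans h₂)]
    exact ⟨h₁, h₂⟩
  obtain ⟨s, t, hs, ht, hst, rfl⟩ := hmem
  refine ⟨s, t, hs, ht, hst, ?_⟩
  funext i
  refine Fin.lastCases ?_ (fun j => ?_) i
  · simp
  · simp only [Pi.add_apply, Pi.smul_apply, Fin.snoc_castSucc, smul_eq_mul, Fin.init]
    rw [← add_mul, hst, one_mul]

theorem slice {d : ℕ} {S : Set (Fin (d + 1) → ℝ)} (hS : StairConvex S) (h : ℝ) :
    StairConvex {y : Fin d → ℝ | (Fin.snoc y h : Fin (d + 1) → ℝ) ∈ S} := by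
  intro a ha b hb z hz
  refine hS _ ha _ hb ?_
  rw [stairPath, if_pos (by simp)]
  right
  exact ⟨z, by simpa using hz, by simp⟩

end StairConvex

theorem volume_init_last_cylinder {d : ℕ} (A : Set (Fin d → ℝ)) (B : Set ℝ) :
    volume {x : Fin (d + 1) → ℝ | Fin.init x ∈ A ∧ x (Fin.last d) ∈ B} =
      volume B * volume A := by
  have h := (volume_preserving_piFinSuccAbove (fun _ : Fin (d + 1) => ℝ)
    (Fin.last d)).measure_preimage_equiv (B ×ˢ A)
  rw [Measure.volume_eq_prod, Measure.prod_prod] at h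
  rw [← h]
  congr 1
  ext x
  simp [MeasurableEquiv.piFinSuccAbove, Fin.insertNthEquiv, Fin.removeNth_last, and_comm]

theorem init_mem_unitCube {d : ℕ} {x : Fin (d + 1) → ℝ} (hx : x ∈ unitCube (d + 1)) :
    Fin.init x ∈ unitCube d :=
  ⟨fun i => hx.1 i.castSucc, fun i => hx.2 i.castSucc⟩

theorem volume_unitCube (d : ℕ) : volume (unitCube d) = 1 := by
  simp [unitCube, Real.volume_Icc_pi]

/-! ### Large boxes inside stair-convex sets -/

/-- `S` contains an open axis-parallel box of volume at least `δ` that lies in the unit cube. -/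
def ContainsBox {d : ℕ} (S : Set (Fin d → ℝ)) (δ : ℝ) : Prop :=
  ∃ a b : Fin d → ℝ, 0 ≤ a ∧ b ≤ 1 ∧ (∀ i, a i < b i) ∧
    (Set.univ.pi fun i => Set.Ioo (a i) (b i)) ⊆ S ∧ δ ≤ ∏ i, (b i - a i)

/-- The supremum of the heights of a nonempty subset of the unit cube. -/
theorem exists_isLUB_height {d : ℕ} {S : Set (Fin (d + 1) → ℝ)} (hS : S ⊆ unitCube (d + 1))
    (hne : S.Nonempty) :
    ∃ τ ≤ 1, IsLUB ((fun x : Fin (d + 1) → ℝ => x (Fin.last d)) '' S) τ := by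
  have hub : (1 : ℝ) ∈ upperBounds ((fun x : Fin (d + 1) → ℝ => x (Fin.last d)) '' S) := by
    rintro _ ⟨x, hx, rfl⟩
    exact (hS hx).2 _
  exact ⟨_, csSup_le (hne.image _) hub, isLUB_csSup (hne.image _) ⟨1, hub⟩⟩

theorem exists_dyadic_gap {t : ℝ} (ht : t ≤ 1) (L : ℕ) :
    t ≤ (1 / 2) ^ L ∨ ∃ i < L, (1 / 2) ^ (i + 1) ≤ t ∧ t ≤ (1 / 2) ^ i := by
  induction L with
  | zero => exact Or.inl (by simpa using ht)
  | succ L ih =>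
    rcases ih with h | ⟨i, hi, h⟩
    · rcases le_total t ((1 / 2) ^ (L + 1)) with h' | h'
      · exact Or.inl h'
      · exact Or.inr ⟨L, L.lt_succ_self, h', h⟩
    · exact Or.inr ⟨i, hi.trans L.lt_succ_self, h⟩

theorem ContainsBox.of_slice {d : ℕ} {S : Set (Fin (d + 1) → ℝ)} (hS : StairConvex S)
    (hcube : S ⊆ unitCube (d + 1)) {τ s δ : ℝ}
    (hτ : IsLUB ((fun x : Fin (d + 1) → ℝ => x (Fin.last d)) '' S) τ) (hτ1 : τ ≤ 1)
    (hs : 0 < s)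
    (hbox : ContainsBox {y : Fin d → ℝ | (Fin.snoc y (τ - s) : Fin (d + 1) → ℝ) ∈ S} δ) :
    ContainsBox S (δ * s) := by
  obtain ⟨a, b, ha, hb, hab, hsub, hδ⟩ := hbox
  have hs0 : 0 ≤ τ - s := by
    have hmid : (fun i => (a i + b i) / 2) ∈ Set.univ.pi fun i => Set.Ioo (a i) (b i) :=
      fun i _ => ⟨by linarith [hab i], by linarith [hab i]⟩
    simpa using (hcube (hsub hmid)).1 (Fin.last d)
  refine ⟨Fin.snoc a (τ - s), Fin.snoc b τ, ?_, ?_, ?_, ?_, ?_⟩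
  · intro i
    refine Fin.lastCases ?_ (fun j => ?_) i
    · simpa using hs0
    · simpa using ha j
  · intro i
    refine Fin.lastCases ?_ (fun j => ?_) i
    · simpa using hτ1
    · simpa using hb j
  · intro i
    refine Fin.lastCases ?_ (fun j => ?_) i
    · simpa using hs
    · simpa using hab j
  · intro x hx
    have hlast : τ - s < x (Fin.last d) ∧ x (Fin.last d) < τ := by
      simpa using hx (Fin.last d) trivial
    have hinit : (Fin.snoc (Fin.init x) (τ - s) : Fin (d + 1) → ℝ) ∈ S :=
      hsub fun i _ => by simpa [Fin.init] using hx i.castSucc trivial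
    obtain ⟨_, ⟨z, hz, rfl⟩, hxz⟩ := (lt_isLUB_iff hτ).1 hlast.2
    have := hS.snoc_init_mem hinit hz (h := x (Fin.last d)) (by simpa using hlast.1.le) hxz.le
    simpa using this
  · rw [Fin.prod_univ_castSucc]
    simp only [Fin.snoc_castSucc, Fin.snoc_last, sub_sub_cancel]
    gcongr

theorem exists_slice_volume_ge {d : ℕ} {S : Set (Fin (d + 1) → ℝ)} (hS : StairConvex S)
    (hcube : S ⊆ unitCube (d + 1)) {τ ε : ℝ} {L : ℕ}
    (hτ : IsLUB ((fun x : Fin (d + 1) → ℝ => x (Fin.last d)) '' S) τ) (hτ1 : τ ≤ 1)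
    (hL : 0 < L) (hLε : 4 * (1 / 2) ^ L ≤ ε) (hvol : ENNReal.ofReal ε ≤ volume S) :
    ∃ i < L, ENNReal.ofReal (ε / (2 * L) / (1 / 2) ^ (i + 1)) ≤
      volume {y : Fin d → ℝ | (Fin.snoc y (τ - (1 / 2) ^ (i + 1)) : Fin (d + 1) → ℝ) ∈ S} := by
  by_contra! hcon
  have hL' : (0 : ℝ) < L := by exact_mod_cast hL
  have hpow : (0 : ℝ) < (1 / 2) ^ L := by positivity
  have hε : 0 < ε := by linarith
  set T : ℕ → Set (Fin d → ℝ) := fun i =>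
    {y | (Fin.snoc y (τ - (1 / 2) ^ (i + 1)) : Fin (d + 1) → ℝ) ∈ S}
  have hcover : S ⊆
      {x | Fin.init x ∈ unitCube d ∧ x (Fin.last d) ∈ Set.Icc (τ - (1 / 2) ^ L) τ} ∪
      ⋃ i ∈ Finset.range L, {x | Fin.init x ∈ T i ∧
        x (Fin.last d) ∈ Set.Icc (τ - (1 / 2) ^ i) (τ - (1 / 2) ^ (i + 1))} := by
    intro x hx
    have hx0 : 0 ≤ x (Fin.last d) := (hcube hx).1 _
    have hxτ : x (Fin.last d) ≤ τ := hτ.1 ⟨x, hx, rfl⟩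
    rcases exists_dyadic_gap (t := τ - x (Fin.last d)) (by linarith) L with h | ⟨i, hi, h₁, h₂⟩
    · exact Or.inl ⟨init_mem_unitCube (hcube hx), by linarith, hxτ⟩
    · refine Or.inr ?_
      simp only [Set.mem_iUnion, Finset.mem_range]
      refine ⟨i, hi, ?_, by linarith, by linarith⟩
      have hlt : τ - (1 / 2) ^ (i + 1) < τ := by
        have : (0 : ℝ) < (1 / 2) ^ (i + 1) := by positivity
        linarith
      obtain ⟨_, ⟨z, hz, rfl⟩, hxz⟩ := (lt_isLUB_iff hτ).1 hlt
      exact hS.snoc_init_mem hx hz (by linarith) hxz.le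
  have hpiece : ∀ i ∈ Finset.range L, volume {x : Fin (d + 1) → ℝ | Fin.init x ∈ T i ∧
      x (Fin.last d) ∈ Set.Icc (τ - (1 / 2) ^ i) (τ - (1 / 2) ^ (i + 1))} ≤
      ENNReal.ofReal (ε / (2 * L)) := by
    intro i hi
    have hi' : (0 : ℝ) < (1 / 2) ^ (i + 1) := by positivity
    rw [volume_init_last_cylinder, Real.volume_Icc]
    calc _ ≤ ENNReal.ofReal ((1 / 2) ^ (i + 1)) *
          ENNReal.ofReal (ε / (2 * L) / (1 / 2) ^ (i + 1)) := by
          refine mul_le_mul' (ENNReal.ofReal_le_ofReal (le_of_eq ?_))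
            (hcon i (Finset.mem_range.1 hi)).le
          ring
      _ = ENNReal.ofReal (ε / (2 * L)) := by
          rw [← ENNReal.ofReal_mul hi'.le, mul_div_cancel₀ _ hi'.ne']
  have hle : volume S ≤ ENNReal.ofReal ((1 / 2) ^ L + ε / 2) := by
    refine (measure_mono hcover).trans ((measure_union_le _ _).trans ?_)
    rw [ENNReal.ofReal_add hpow.le (by positivity)]
    refine add_le_add ?_ ?_
    · rw [volume_init_last_cylinder, volume_unitCube, Real.volume_Icc, mul_one, sub_sub_cancel]
    · refine (measure_biUnion_finset_le _ _).trans ((Finset.sum_le_sum hpiece).trans ?_)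
      rw [Finset.sum_const, Finset.card_range, ← ENNReal.ofReal_nsmul, nsmul_eq_mul]
      refine ENNReal.ofReal_le_ofReal (le_of_eq ?_)
      field_simp
  have := (ENNReal.ofReal_le_ofReal_iff (by positivity)).1 (hvol.trans hle)
  linarith

/-- One-dimensional stair-convex sets contain the interior of their convex hull. -/
theorem StairConvex.containsBox_one {S : Set (Fin 1 → ℝ)} (hS : StairConvex S)
    (hcube : S ⊆ unitCube 1) {ε : ℝ} (hε : 0 < ε) (hvol : ENNReal.ofReal ε ≤ volume S) :
    ContainsBox S ε := by
  have hne : S.Nonempty := by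
    refine nonempty_of_measure_ne_zero (μ := volume) fun h => ?_
    rw [h] at hvol
    simp only [nonpos_iff_eq_zero, ENNReal.ofReal_eq_zero] at hvol
    linarith
  obtain ⟨τ, hτ1, hτ⟩ := exists_isLUB_height hcube hne
  have hlb : (0 : ℝ) ∈ lowerBounds ((fun x : Fin 1 → ℝ => x (Fin.last 0)) '' S) := by
    rintro _ ⟨x, hx, rfl⟩
    exact (hcube hx).1 _
  have hσ := isGLB_csInf (hne.image fun x : Fin 1 → ℝ => x (Fin.last 0)) ⟨0, hlb⟩
  set σ := sInf ((fun x : Fin 1 → ℝ => x (Fin.last 0)) '' S)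
  have hσ0 : 0 ≤ σ := hσ.2 hlb
  have hcov : S ⊆ Set.Icc (fun _ => σ) (fun _ => τ) := by
    intro x hx
    refine ⟨fun i => ?_, fun i => ?_⟩
    · rw [Subsingleton.elim i (Fin.last 0)]
      exact hσ.1 ⟨x, hx, rfl⟩
    · rw [Subsingleton.elim i (Fin.last 0)]
      exact hτ.1 ⟨x, hx, rfl⟩
  have hle := hvol.trans (measure_mono hcov)
  rw [Real.volume_Icc_pi, Fin.prod_univ_one, ENNReal.ofReal_le_ofReal_iff'] at hle
  have hlen : ε ≤ τ - σ := hle.resolve_right hε.not_ge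
  refine ⟨fun _ => σ, fun _ => τ, fun _ => hσ0, fun _ => hτ1, fun _ => by linarith, ?_,
    by simpa using hlen⟩
  intro x hx
  have hx' := hx (Fin.last 0) trivial
  obtain ⟨_, ⟨z, hz, rfl⟩, hxz⟩ := (lt_isLUB_iff hτ).1 hx'.2
  obtain ⟨_, ⟨w, hw, rfl⟩, hwx⟩ := (isGLB_lt_iff hσ).1 hx'.1
  have := hS.snoc_init_mem hw hz hwx.le hxz.le
  rwa [Subsingleton.elim (Fin.init w) (Fin.init x), Fin.snoc_init_self] at this

/-- A stair-convex set of volume `ε` contains a box of volume `ε / (2L)^e`, where `e + 1` is the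
dimension and `L` is of order `log (1 / ε)`. -/
theorem StairConvex.containsBox {L : ℕ} (hL : 0 < L) (e : ℕ) {S : Set (Fin (e + 1) → ℝ)}
    (hS : StairConvex S) (hcube : S ⊆ unitCube (e + 1)) {ε : ℝ}
    (hLε : 4 * (1 / 2) ^ L * (2 * L) ^ e ≤ ε) (hvol : ENNReal.ofReal ε ≤ volume S) :
    ContainsBox S (ε / (2 * L) ^ e) := by
  have hL1 : (1 : ℝ) ≤ L := by exact_mod_cast hL
  induction e generalizing ε with
  | zero =>
    simpa using hS.containsBox_one hcube (lt_of_lt_of_le (by positivity) hLε) hvol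
  | succ e ih =>
    have hε : 0 < ε := lt_of_lt_of_le (by positivity) hLε
    have hne : S.Nonempty := by
      refine nonempty_of_measure_ne_zero (μ := volume) fun h => ?_
      rw [h] at hvol
      simp only [nonpos_iff_eq_zero, ENNReal.ofReal_eq_zero] at hvol
      linarith
    obtain ⟨τ, hτ1, hτ⟩ := exists_isLUB_height hcube hne
    have hLε' : 4 * (1 / 2 : ℝ) ^ L ≤ ε :=
      (le_mul_of_one_le_right (by positivity) (one_le_pow₀ (by linarith))).trans hLε
    obtain ⟨i, -, hi⟩ := exists_slice_volume_ge hS hcube hτ hτ1 hL hLε' hvol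
    have hp : (0 : ℝ) < (1 / 2) ^ (i + 1) := by positivity
    have hslice : {y : Fin (e + 1) → ℝ | (Fin.snoc y (τ - (1 / 2) ^ (i + 1)) :
        Fin (e + 1 + 1) → ℝ) ∈ S} ⊆ unitCube (e + 1) := fun y hy => by
      simpa using init_mem_unitCube (hcube hy)
    have hbound : 4 * (1 / 2) ^ L * (2 * L) ^ e ≤ ε / (2 * L) / (1 / 2 : ℝ) ^ (i + 1) := by
      refine le_trans ?_ (le_div_self (by positivity) hp (pow_le_one₀ (by norm_num) (by norm_num)))
      rw [le_div_iff₀ (by positivity)]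
      calc _ = 4 * (1 / 2) ^ L * (2 * L : ℝ) ^ (e + 1) := by ring
        _ ≤ ε := hLε
    have := ContainsBox.of_slice hS hcube hτ hτ1 hp (ih (hS.slice _) hslice hbound hi)
    convert this using 1
    field_simp
    ring

/-! ### Halton points meet every large box -/

/-- The van der Corput radical inverse: the base-`b` digits of `n` reflected at the radix point. -/
noncomputable def radicalInverse (b n : ℕ) : ℝ :=
  if _h : 2 ≤ b ∧ 0 < n then ((n % b : ℕ) + radicalInverse b (n / b)) / b else 0
termination_by n
decreasing_by exact Nat.div_lt_self _h.2 _h.1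

theorem radicalInverse_eq {b : ℕ} (hb : 2 ≤ b) (n : ℕ) :
    radicalInverse b n = ((n % b : ℕ) + radicalInverse b (n / b)) / b := by
  rcases Nat.eq_zero_or_pos n with rfl | hn
  · have h0 : radicalInverse b 0 = 0 := by rw [radicalInverse]; simp
    simp [h0]
  · rw [radicalInverse, dif_pos ⟨hb, hn⟩]

theorem radicalInverse_mem_Ico {b : ℕ} (hb : 2 ≤ b) (n : ℕ) :
    radicalInverse b n ∈ Set.Ico (0 : ℝ) 1 := by
  induction n using Nat.strong_induction_on with
  | _ n ih =>
    rcases Nat.eq_zero_or_pos n with rfl | hn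
    · rw [radicalInverse]; simp
    · have hb0 : (0 : ℝ) < b := by positivity
      have h := ih _ (Nat.div_lt_self hn hb)
      have hmod : ((n % b : ℕ) : ℝ) + 1 ≤ b := by exact_mod_cast Nat.mod_lt n (by omega)
      rw [radicalInverse_eq hb]
      refine ⟨div_nonneg (add_nonneg (by positivity) h.1) hb0.le, ?_⟩
      rw [div_lt_one hb0]
      linarith [h.2]

theorem exists_residue_radicalInverse_mem {b : ℕ} (hb : 2 ≤ b) (k c : ℕ) (hc : c < b ^ k) :
    ∃ m : ℕ, ∀ n : ℕ, n ≡ m [MOD b ^ k] →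
      radicalInverse b n ∈ Set.Ico ((c : ℝ) / b ^ k) ((c + 1) / b ^ k) := by
  induction k generalizing c with
  | zero =>
    obtain rfl : c = 0 := by simpa using hc
    exact ⟨0, fun n _ => by simpa using radicalInverse_mem_Ico hb n⟩
  | succ k ih =>
    have hb0 : 0 < b := by omega
    have hbk : 0 < b ^ k := by positivity
    obtain ⟨m, hm⟩ := ih (c % b ^ k) (Nat.mod_lt _ hbk)
    have hq : c / b ^ k < b := by
      rw [Nat.div_lt_iff_lt_mul hbk, mul_comm, ← pow_succ]
      exact hc
    refine ⟨c / b ^ k + b * m, fun n hn => ?_⟩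
    have hmod : n % b = c / b ^ k := by
      have h := hn.of_dvd (Dvd.intro_left (b ^ k) (pow_succ b k).symm)
      rw [Nat.ModEq, Nat.add_mul_mod_self_left, Nat.mod_eq_of_lt hq] at h
      exact h
    have hdiv : n / b ≡ m [MOD b ^ k] := by
      have hn' : n = c / b ^ k + b * (n / b) := by
        rw [← hmod]
        exact (Nat.mod_add_div n b).symm
      rw [hn', pow_succ, mul_comm (b ^ k)] at hn
      exact Nat.ModEq.mul_left_cancel' hb0.ne' (Nat.ModEq.add_left_cancel' _ hn)
    have h := hm _ hdiv
    have hcdecomp : (c : ℝ) = b ^ k * (c / b ^ k : ℕ) + (c % b ^ k : ℕ) := by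
      exact_mod_cast (Nat.div_add_mod c (b ^ k)).symm
    have hbR : (0 : ℝ) < b := by exact_mod_cast hb0
    have hbkR : (0 : ℝ) < (b : ℝ) ^ k := by positivity
    rw [Set.mem_Ico, div_le_iff₀ hbkR, lt_div_iff₀ hbkR] at h
    rw [radicalInverse_eq hb, hmod, Set.mem_Ico, pow_succ, ← div_div, ← div_div,
      div_le_div_iff_of_pos_right hbR, div_lt_div_iff_of_pos_right hbR, div_le_iff₀ hbkR,
      lt_div_iff₀ hbkR]
    constructor <;> nlinarith [h.1, h.2]

theorem exists_adic_interval {b : ℕ} (hb : 2 ≤ b) {u v : ℝ} (hu : 0 ≤ u) (hv : v ≤ 1)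
    (huv : u < v) :
    ∃ k c : ℕ, c < b ^ k ∧ (b : ℝ) ^ k ≤ 2 * b / (v - u) ∧
      Set.Ico ((c : ℝ) / b ^ k) ((c + 1) / b ^ k) ⊆ Set.Ioo u v := by
  have hl : 0 < v - u := sub_pos.2 huv
  have hbR : (1 : ℝ) < b := by exact_mod_cast hb
  have hx : 1 ≤ 2 / (v - u) := by
    rw [le_div_iff₀ hl]
    linarith
  obtain ⟨n, hn₁, hn₂⟩ := exists_nat_pow_near hx hbR
  have hpos : (0 : ℝ) < (b : ℝ) ^ (n + 1) := by positivity
  rw [div_lt_iff₀ hl] at hn₂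
  have hfl := Nat.floor_le (mul_nonneg hu hpos.le)
  have hfl' := Nat.lt_floor_add_one (u * (b : ℝ) ^ (n + 1))
  have hvp : v * (b : ℝ) ^ (n + 1) ≤ b ^ (n + 1) := mul_le_of_le_one_left hpos.le hv
  refine ⟨n + 1, ⌊u * (b : ℝ) ^ (n + 1)⌋₊ + 1, ?_, ?_, ?_⟩
  · have : ((⌊u * (b : ℝ) ^ (n + 1)⌋₊ + 1 : ℕ) : ℝ) < ((b ^ (n + 1) : ℕ) : ℝ) := by
      push_cast
      nlinarith
    exact_mod_cast this
  · calc (b : ℝ) ^ (n + 1) = b ^ n * b := pow_succ _ _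
      _ ≤ 2 / (v - u) * b := by gcongr
      _ = 2 * b / (v - u) := by ring
  · rintro x ⟨hx₁, hx₂⟩
    rw [div_le_iff₀ hpos] at hx₁
    rw [lt_div_iff₀ hpos] at hx₂
    push_cast at hx₁ hx₂
    constructor
    · exact lt_of_mul_lt_mul_right (hfl'.trans_le hx₁) hpos.le
    · refine lt_of_mul_lt_mul_right (hx₂.trans_le ?_) hpos.le
      nlinarith

/-- The `n`-th Halton point, with the first `d` primes as bases. -/
noncomputable def halton (d n : ℕ) : Fin d → ℝ :=
  fun i => radicalInverse (Nat.nth Nat.Prime i) n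

theorem halton_mem_unitCube (d n : ℕ) : halton d n ∈ unitCube d :=
  ⟨fun i => (radicalInverse_mem_Ico (Nat.prime_nth_prime i).two_le n).1,
    fun i => (radicalInverse_mem_Ico (Nat.prime_nth_prime i).two_le n).2.le⟩

theorem exists_halton_mem {d : ℕ} {S : Set (Fin d → ℝ)} {δ : ℝ} (hδ : 0 < δ)
    (hS : ContainsBox S δ) :
    ∃ n : ℕ, (n : ℝ) < (∏ i : Fin d, (2 * (Nat.nth Nat.Prime i : ℝ))) / δ ∧ halton d n ∈ S := by
  obtain ⟨a, b, ha, hb, hab, hsub, hvol⟩ := hS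
  have hp : ∀ i : Fin d, (Nat.nth Nat.Prime i).Prime := fun i => Nat.prime_nth_prime i
  choose k c hc hk hI using fun i : Fin d =>
    exists_adic_interval (hp i).two_le (ha i) (hb i) (hab i)
  choose m hm using fun i : Fin d =>
    exists_residue_radicalInverse_mem (hp i).two_le (k i) (c i) (hc i)
  have hne : ∀ i ∈ (Finset.univ : Finset (Fin d)), Nat.nth Nat.Prime i ^ k i ≠ 0 :=
    fun i _ => pow_ne_zero _ (hp i).ne_zero
  have hcop : Set.Pairwise ((Finset.univ : Finset (Fin d)) : Set (Fin d))
      (Function.onFun Nat.Coprime fun i : Fin d => Nat.nth Nat.Prime i ^ k i) := by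
    intro i _ j _ hij
    refine Nat.Coprime.pow _ _ ((Nat.coprime_primes (hp i) (hp j)).2 fun h => hij ?_)
    exact Fin.ext (Nat.nth_injective Nat.infinite_setOfPred_prime h)
  let x := Nat.chineseRemainderOfFinset m (fun i : Fin d => Nat.nth Nat.Prime i ^ k i)
    Finset.univ hne hcop
  refine ⟨x, ?_, hsub fun i _ => hI i (hm i _ (x.2 i (Finset.mem_univ i)))⟩
  have hlt : (x : ℕ) < ∏ i : Fin d, Nat.nth Nat.Prime i ^ k i :=
    Nat.chineseRemainderOfFinset_lt_prod _ _ _ _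
  calc ((x : ℕ) : ℝ) < ∏ i : Fin d, (Nat.nth Nat.Prime i : ℝ) ^ k i := by exact_mod_cast hlt
    _ ≤ ∏ i : Fin d, 2 * (Nat.nth Nat.Prime i : ℝ) / (b i - a i) :=
        Finset.prod_le_prod (fun i _ => by positivity) fun i _ => hk i
    _ = (∏ i : Fin d, 2 * (Nat.nth Nat.Prime i : ℝ)) / ∏ i, (b i - a i) := Finset.prod_div_distrib ..
    _ ≤ _ := by gcongr

/-- `O(1 / δ)` points suffice to meet every set that contains a box of volume `δ`. -/
theorem exists_finset_box_net (d : ℕ) :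
    ∃ K : ℝ, 0 < K ∧ ∀ δ : ℝ, 0 < δ → δ ≤ 1 → ∃ N : Finset (Fin d → ℝ),
      (↑N : Set (Fin d → ℝ)) ⊆ unitCube d ∧ (N.card : ℝ) ≤ K / δ ∧
      ∀ S : Set (Fin d → ℝ), ContainsBox S δ → ((↑N : Set (Fin d → ℝ)) ∩ S).Nonempty := by
  set P : ℝ := ∏ i : Fin d, (2 * (Nat.nth Nat.Prime i : ℝ))
  have hP0 : 0 < P := Finset.prod_pos fun i _ => by
    have := (Nat.prime_nth_prime i).pos
    positivity
  classical
  refine ⟨P + 1, by positivity, fun δ hδ hδ1 =>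
    ⟨(Finset.range ⌈P / δ⌉₊).image (halton d), ?_, ?_, fun S hS => ?_⟩⟩
  · intro x hx
    obtain ⟨n, -, rfl⟩ := Finset.mem_image.1 (Finset.mem_coe.1 hx)
    exact halton_mem_unitCube d n
  · have hcard : (((Finset.range ⌈P / δ⌉₊).image (halton d)).card : ℝ) ≤ ⌈P / δ⌉₊ := by
      exact_mod_cast Finset.card_image_le.trans (Finset.card_range _).le
    have hceil := Nat.ceil_lt_add_one (div_pos hP0 hδ).le
    have : 1 ≤ 1 / δ := by rwa [le_div_iff₀ hδ, one_mul]
    rw [add_div]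
    linarith
  · obtain ⟨n, hn, hnS⟩ := exists_halton_mem hδ hS
    exact ⟨halton d n, by
      simpa using ⟨n, Nat.lt_ceil.2 hn, rfl⟩, hnS⟩

/-! ### Choice of parameters -/

theorem exists_scale_le_log (e : ℕ) :
    ∃ A : ℝ, 0 < A ∧ ∀ r : ℝ, 2 ≤ r → ∃ L : ℕ, 0 < L ∧
      4 * (1 / 2) ^ L * (2 * (L : ℝ)) ^ e ≤ 1 / r ∧ (2 * (L : ℝ)) ≤ A * Real.log r := by
  have hlim := tendsto_pow_const_mul_const_pow_of_lt_one e (r := (1 / 2 : ℝ)) (by norm_num)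
    (by norm_num)
  obtain ⟨m₀, hm₀⟩ := Filter.eventually_atTop.1
    (hlim.eventually (ge_mem_nhds (show (0 : ℝ) < 1 / (4 * 4 ^ e) by positivity)))
  have hlog2 : 0 < Real.log 2 := Real.log_pos (by norm_num)
  refine ⟨4 * ((m₀ + 2) / Real.log 2), by positivity, fun r hr => ?_⟩
  have hr0 : 0 < r := by linarith
  have hlogr : Real.log 2 ≤ Real.log r := Real.log_le_log (by norm_num) hr
  set q := Real.log r / Real.log 2 with hq
  have hq1 : 1 ≤ q := by rwa [hq, le_div_iff₀ hlog2, one_mul]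
  have hpow : r ≤ 2 ^ (⌈q⌉₊ + m₀) := by
    rw [← Real.log_le_log_iff hr0 (by positivity), Real.log_pow, ← div_le_iff₀ hlog2]
    push_cast
    have := Nat.le_ceil q
    have : (0 : ℝ) ≤ m₀ := by positivity
    linarith
  have hm := hm₀ (⌈q⌉₊ + m₀) (by omega)
  have hmle : ((⌈q⌉₊ + m₀ : ℕ) : ℝ) ≤ (m₀ + 2) * q := by
    push_cast
    have := Nat.ceil_lt_add_one (zero_le_one.trans hq1)
    have : (m₀ : ℝ) ≤ m₀ * q := le_mul_of_one_le_right (by positivity) hq1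
    linarith
  have hmpos : 0 < ⌈q⌉₊ + m₀ := by
    have := Nat.ceil_pos.2 (zero_lt_one.trans_le hq1)
    omega
  set M := ⌈q⌉₊ + m₀
  refine ⟨2 * M, by omega, ?_, ?_⟩
  · rw [le_div_iff₀ (by positivity)] at hm
    calc 4 * (1 / 2) ^ (2 * M) * (2 * ((2 * M : ℕ) : ℝ)) ^ e
        = ((M : ℝ) ^ e * (1 / 2) ^ M * (4 * 4 ^ e)) * (1 / 2) ^ M := by
          push_cast
          rw [← mul_assoc, mul_pow, two_mul M, pow_add]
          norm_num
          ring
      _ ≤ 1 * (1 / 2) ^ M := by gcongr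
      _ ≤ 1 / r := by
          rw [one_mul, one_div_pow]
          exact one_div_le_one_div_of_le hr0 hpow
  · push_cast
    calc 2 * (2 * (M : ℝ)) ≤ 4 * ((m₀ + 2) * q) := by linarith
      _ = _ := by rw [hq]; ring

/-- For every `r ≥ 2` there is a `1/r`-net for `[0,1]^d` with respect to stair-convex
sets having at most `C · r · (log r)^(d-1)` points. -/
theorem stair_convex_net_upper_bound (d : ℕ) (hd : 1 ≤ d) :
    ∃ C : ℝ, 0 < C ∧ ∀ r : ℝ, 2 ≤ r →
      ∃ N : Finset (Fin d → ℝ), IsStairNet d (1 / r) (↑N : Set (Fin d → ℝ)) ∧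
        (N.card : ℝ) ≤ C * r * (Real.log r) ^ (d - 1) := by
  obtain ⟨e, rfl⟩ := Nat.exists_eq_add_of_le' hd
  obtain ⟨K, hK, hnet⟩ := exists_finset_box_net (e + 1)
  obtain ⟨A, hA, hscale⟩ := exists_scale_le_log e
  refine ⟨K * A ^ e, by positivity, fun r hr => ?_⟩
  obtain ⟨L, hL, hLr, hLA⟩ := hscale r hr
  have hr0 : 0 < r := by linarith
  have hL1 : (1 : ℝ) ≤ L := by exact_mod_cast hL
  have hpow : 1 ≤ (2 * (L : ℝ)) ^ e := one_le_pow₀ (by linarith)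
  have hδ1 : 1 / r / (2 * (L : ℝ)) ^ e ≤ 1 :=
    div_le_one_of_le₀ ((div_le_one_of_le₀ (by linarith) hr0.le).trans hpow) (by positivity)
  obtain ⟨N, hN, hcard, hhit⟩ := hnet (1 / r / (2 * (L : ℝ)) ^ e) (by positivity) hδ1
  refine ⟨N, ⟨hN, fun S hcube hS hvol => hhit S (hS.containsBox hL e hcube hLr hvol)⟩, ?_⟩
  calc (N.card : ℝ) ≤ K * r * (2 * (L : ℝ)) ^ e := by
        refine hcard.trans (le_of_eq ?_)
        field_simp
    _ ≤ K * r * (A * Real.log r) ^ e := by gcongr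
    _ = K * A ^ e * r * Real.log r ^ (e + 1 - 1) := by
        rw [mul_pow, Nat.add_sub_cancel]
        ring
end

section
/- Fix integers d ≥ 2 and m ≥ 2, and define K_1 = 2^d and K_{i+1} = 2^d · K_i^{m−1} for 1 ≤ i < d; let B = ∏_{i=1}^d [1, K_i^{m−1}] ⊂ ℝ^d. Let P and Q be finite subsets of B that are far apart. Then sconv(P) ∩ sconv(Q) ≠ ∅ if and only if conv(P) ∩ conv(Q) ≠ ∅, where conv denotes the ordinary convex hull. -/
/-- The stair-convex hull: the intersection of all stair-convex sets containing `X`. -/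
def sconv {d : ℕ} (X : Set (Fin d → ℝ)) : Set (Fin d → ℝ) :=
  ⋂₀ {S : Set (Fin d → ℝ) | StairConvex S ∧ X ⊆ S}

/-- The constants of the stretched grid: `K 1 = 2^d`, `K (i+1) = 2^d * (K i)^(m-1)`.
Here `stretchK d m i` denotes `K_{i+1}` (0-based index `i`). -/
def stretchK (d m : ℕ) : ℕ → ℝ
  | 0 => 2 ^ d
  | (i+1) => 2 ^ d * (stretchK d m i) ^ (m - 1)

/-- The bounding box `B = ∏_{i=1}^d [1, K_i^{m-1}]` of the stretching grid. -/
def stretchBox (d m : ℕ) : Set (Fin d → ℝ) :=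
  {x | ∀ i : Fin d, 1 ≤ x i ∧ x i ≤ (stretchK d m i) ^ (m - 1)}

/-- Points `a, b` are far apart if in each coordinate they differ by at least the
factor `K_i`. -/
def FarApart {d : ℕ} (m : ℕ) (a b : Fin d → ℝ) : Prop :=
  ∀ i : Fin d, stretchK d m i * a i ≤ b i ∨ stretchK d m i * b i ≤ a i

/-- Membership in the stair-convex hull of the family `p` restricted to `A`, by recursion on the
dimension: some point lies weakly above `x` in the last coordinate, and the projection of `x`
belongs to the hull of the projections of the points weakly below it. -/
def InStairHull {ι : Type*} : (n : ℕ) → Set ι → (ι → Fin n → ℝ) → (Fin n → ℝ) → Prop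
  | 0, A, _, _ => A.Nonempty
  | (n+1), A, p, x =>
    (∃ a ∈ A, x (Fin.last n) ≤ p a (Fin.last n)) ∧
      InStairHull n {a | a ∈ A ∧ p a (Fin.last n) ≤ x (Fin.last n)}
        (fun a => Fin.init (p a)) (Fin.init x)

/-- Combinatorial form of the statement that two stair-convex hulls intersect; it only depends on
the coordinatewise comparisons between the two families. -/
def StairMeet {ι κ : Type*} :
    (n : ℕ) → Set ι → Set κ → (ι → Fin n → ℝ) → (κ → Fin n → ℝ) → Prop
  | 0, A, B, _, _ => A.Nonempty ∧ B.Nonempty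
  | (n+1), A, B, p, q =>
    StairMeet n {a | a ∈ A ∧ ∃ b ∈ B, p a (Fin.last n) ≤ q b (Fin.last n)}
      {b | b ∈ B ∧ ∃ a ∈ A, q b (Fin.last n) ≤ p a (Fin.last n)}
      (fun a => Fin.init (p a)) (fun b => Fin.init (q b))

/-- Two families of points in the box `∏ [1, M i]` whose coordinates differ by a factor of at
least `(n + 1) * F i`, where `F` dominates all earlier sides of the box. -/
structure FarFamilies {ι κ : Type*} (F M : ℕ → ℝ) (n : ℕ) (p : ι → Fin n → ℝ)
    (q : κ → Fin n → ℝ) : Prop where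
  one_le_factor : ∀ i, 1 ≤ F i
  side_le_factor : ∀ i j, i < j → M i ≤ F j
  one_le_left : ∀ a i, 1 ≤ p a i
  left_le : ∀ a i, p a i ≤ M i
  one_le_right : ∀ b i, 1 ≤ q b i
  right_le : ∀ b i, q b i ≤ M i
  far : ∀ a b (i : Fin n), (n + 1) * F i * p a i ≤ q b i ∨ (n + 1) * F i * q b i ≤ p a i

section StairHull

variable {ι : Type*}

lemma InStairHull.mono {n : ℕ} {A A' : Set ι} {p : ι → Fin n → ℝ} {x : Fin n → ℝ}
    (hA : A ⊆ A') (h : InStairHull n A p x) : InStairHull n A' p x := by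
  induction n generalizing A A' with
  | zero => exact Set.Nonempty.mono hA h
  | succ n ih =>
    obtain ⟨⟨a, ha, hxa⟩, h⟩ := h
    exact ⟨⟨a, hA ha, hxa⟩, ih (fun b hb => ⟨hA hb.1, hb.2⟩) h⟩

lemma inStairHull_of_mem {n : ℕ} {A : Set ι} (p : ι → Fin n → ℝ) {a : ι} (ha : a ∈ A) :
    InStairHull n A p (p a) := by
  induction n generalizing A with
  | zero => exact ⟨a, ha⟩
  | succ n ih => exact ⟨⟨a, ha, le_rfl⟩, ih _ ⟨ha, le_rfl⟩⟩

lemma mem_segment_snoc_iff {n : ℕ} {a z : Fin (n + 1) → ℝ} {t : ℝ}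
    (hat : a (Fin.last n) ≤ t) :
    z ∈ segment ℝ a (Fin.snoc (Fin.init a) t) ↔
      Fin.init z = Fin.init a ∧ a (Fin.last n) ≤ z (Fin.last n) ∧ z (Fin.last n) ≤ t := by
  have key : ∀ θ : ℝ, AffineMap.lineMap a (Fin.snoc (Fin.init a) t : Fin (n + 1) → ℝ) θ =
      (Fin.snoc (Fin.init a) (AffineMap.lineMap (a (Fin.last n)) t θ) : Fin (n + 1) → ℝ) := by
    intro θ
    funext i
    refine Fin.lastCases ?_ (fun i => ?_) i
    · simp [AffineMap.lineMap_apply]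
    · simp [AffineMap.lineMap_apply, Fin.init]
  rw [segment_eq_image_lineMap]
  constructor
  · rintro ⟨θ, hθ, rfl⟩
    rw [key]
    have hmem : AffineMap.lineMap (a (Fin.last n)) t θ ∈ segment ℝ (a (Fin.last n)) t := by
      rw [segment_eq_image_lineMap]
      exact ⟨θ, hθ, rfl⟩
    rw [segment_eq_Icc hat] at hmem
    simpa using hmem
  · rintro ⟨hz, h1, h2⟩
    have hmem : z (Fin.last n) ∈ segment ℝ (a (Fin.last n)) t := by
      rw [segment_eq_Icc hat]
      exact ⟨h1, h2⟩
    rw [segment_eq_image_lineMap] at hmem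
    obtain ⟨θ, hθ, h⟩ := hmem
    refine ⟨θ, hθ, ?_⟩
    rw [key, h, ← hz, Fin.snoc_init_self]

lemma stairConvex_setOf_inStairHull {n : ℕ} (A : Set ι) (p : ι → Fin n → ℝ) :
    StairConvex {x | InStairHull n A p x} := by
  induction n generalizing A with
  | zero => intro a ha b _ z _; exact ha
  | succ n ih =>
    have ordered : ∀ a b : Fin (n + 1) → ℝ, InStairHull (n + 1) A p a →
        InStairHull (n + 1) A p b → a (Fin.last n) ≤ b (Fin.last n) →
        segment ℝ a (Fin.snoc (Fin.init a) (b (Fin.last n))) ∪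
          (fun z => Fin.snoc z (b (Fin.last n))) '' stairPath n (Fin.init a) (Fin.init b) ⊆
        {x | InStairHull (n + 1) A p x} := by
      rintro a b ⟨_, ha⟩ ⟨⟨c, hc, hbc⟩, hb⟩ hab z (hz | ⟨z, hz, rfl⟩)
      · obtain ⟨h0, h1, h2⟩ := (mem_segment_snoc_iff hab).1 hz
        refine ⟨⟨c, hc, h2.trans hbc⟩, ?_⟩
        rw [h0]
        exact ha.mono fun e he => ⟨he.1, he.2.trans h1⟩
      · have ha' : InStairHull n {e | e ∈ A ∧ p e (Fin.last n) ≤ b (Fin.last n)}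
            (fun e => Fin.init (p e)) (Fin.init a) :=
          ha.mono fun e he => ⟨he.1, he.2.trans hab⟩
        have := ih _ _ _ ha' _ hb hz
        refine ⟨⟨c, hc, ?_⟩, ?_⟩ <;> simpa using ‹_›
    intro a ha b hb
    rw [stairPath]
    split_ifs with h
    · exact ordered a b ha hb h
    · exact ordered b a hb ha (le_of_not_ge h)

lemma InStairHull.mem_of_stairConvex {n : ℕ} {A : Set ι} {p : ι → Fin n → ℝ} {x : Fin n → ℝ}
    (h : InStairHull n A p x) {S : Set (Fin n → ℝ)} (hS : StairConvex S)
    (hA : ∀ a ∈ A, p a ∈ S) : x ∈ S := by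
  induction n generalizing A with
  | zero =>
    obtain ⟨a, ha⟩ := h
    rw [Subsingleton.elim x (p a)]
    exact hA a ha
  | succ n ih =>
    obtain ⟨⟨c, hc, hxc⟩, h⟩ := h
    have hslice : StairConvex
        {z : Fin n → ℝ | (Fin.snoc z (x (Fin.last n)) : Fin (n + 1) → ℝ) ∈ S} := by
      intro a ha b hb z hz
      refine hS _ ha _ hb ?_
      rw [stairPath, if_pos (by simp)]
      exact Or.inr ⟨z, by simpa using hz, by simp⟩
    have := ih h hslice (by
      rintro a ⟨ha, hax⟩
      refine hS _ (hA a ha) _ (hA c hc) ?_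
      rw [stairPath, if_pos (hax.trans hxc)]
      refine Or.inl ((mem_segment_snoc_iff (hax.trans hxc)).2 ?_)
      simpa using ⟨hax, hxc⟩)
    simpa using this

lemma mem_sconv_image_iff {n : ℕ} (A : Set ι) (p : ι → Fin n → ℝ) (x : Fin n → ℝ) :
    x ∈ sconv (p '' A) ↔ InStairHull n A p x := by
  constructor
  · intro h
    refine h _ ⟨stairConvex_setOf_inStairHull A p, ?_⟩
    rintro _ ⟨a, ha, rfl⟩
    exact inStairHull_of_mem p ha
  · rintro h S ⟨hS, hA⟩
    exact h.mem_of_stairConvex hS fun a ha => hA ⟨a, ha, rfl⟩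

end StairHull

section StairMeet

variable {ι κ : Type*} {n : ℕ}

lemma StairMeet.mono {A A' : Set ι} {B B' : Set κ} {p : ι → Fin n → ℝ} {q : κ → Fin n → ℝ}
    (hA : A ⊆ A') (hB : B ⊆ B') (h : StairMeet n A B p q) : StairMeet n A' B' p q := by
  induction n generalizing A A' B B' with
  | zero => exact ⟨h.1.mono hA, h.2.mono hB⟩
  | succ n ih =>
    refine ih ?_ ?_ h
    · rintro a ⟨ha, b, hb, hab⟩
      exact ⟨hA ha, b, hB hb, hab⟩
    · rintro b ⟨hb, a, ha, hab⟩
      exact ⟨hB hb, a, hA ha, hab⟩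

lemma StairMeet.symm {A : Set ι} {B : Set κ} {p : ι → Fin n → ℝ} {q : κ → Fin n → ℝ}
    (h : StairMeet n A B p q) : StairMeet n B A q p := by
  induction n generalizing A B with
  | zero => exact And.symm h
  | succ n ih => exact ih h

lemma StairMeet.nonempty_left {A : Set ι} {B : Set κ} {p : ι → Fin n → ℝ}
    {q : κ → Fin n → ℝ} (h : StairMeet n A B p q) : A.Nonempty := by
  induction n generalizing A B with
  | zero => exact h.1
  | succ n ih => exact (ih h).mono fun _ ha => ha.1

lemma StairMeet.congr {A : Set ι} {B : Set κ} {p p' : ι → Fin n → ℝ} {q q' : κ → Fin n → ℝ}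
    (hpq : ∀ a b i, p a i ≤ q b i ↔ p' a i ≤ q' b i)
    (hqp : ∀ a b i, q b i ≤ p a i ↔ q' b i ≤ p' a i)
    (h : StairMeet n A B p q) : StairMeet n A B p' q' := by
  induction n generalizing A B with
  | zero => exact h
  | succ n ih =>
    rw [StairMeet] at h ⊢
    simp only [← hpq, ← hqp]
    exact ih (fun a b i => hpq a b i.castSucc) (fun a b i => hqp a b i.castSucc) h

lemma stairMeet_iff_exists_inStairHull [Finite ι] [Finite κ] (A : Set ι) (B : Set κ)
    (p : ι → Fin n → ℝ) (q : κ → Fin n → ℝ) :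
    StairMeet n A B p q ↔ ∃ x, InStairHull n A p x ∧ InStairHull n B q x := by
  induction n generalizing A B with
  | zero => exact ⟨fun h => ⟨0, h.1, h.2⟩, fun ⟨_, h⟩ => h⟩
  | succ n ih =>
    constructor
    · intro h
      obtain ⟨a, ha, hmaxa⟩ :=
        A.toFinite.exists_maximalFor (fun a => p a (Fin.last n)) A h.nonempty_left
      obtain ⟨b, hb, hmaxb⟩ :=
        B.toFinite.exists_maximalFor (fun b => q b (Fin.last n)) B h.symm.nonempty_left
      obtain ⟨x, hx1, hx2⟩ := (ih _ _ _ _).1 h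
      have hmaxa' : ∀ c ∈ A, p c (Fin.last n) ≤ p a (Fin.last n) := fun c hc =>
        (le_total _ _).elim id (hmaxa hc)
      have hmaxb' : ∀ c ∈ B, q c (Fin.last n) ≤ q b (Fin.last n) := fun c hc =>
        (le_total _ _).elim id (hmaxb hc)
      refine ⟨Fin.snoc x (min (p a (Fin.last n)) (q b (Fin.last n))),
        ⟨⟨a, ha, by simp⟩, ?_⟩, ⟨⟨b, hb, by simp⟩, ?_⟩⟩
      · rw [Fin.init_snoc, Fin.snoc_last]
        refine hx1.mono ?_
        rintro c ⟨hc, e, he, hce⟩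
        exact ⟨hc, le_min (hmaxa' c hc) (hce.trans (hmaxb' e he))⟩
      · rw [Fin.init_snoc, Fin.snoc_last]
        refine hx2.mono ?_
        rintro c ⟨hc, e, he, hce⟩
        exact ⟨hc, le_min (hce.trans (hmaxa' e he)) (hmaxb' c hc)⟩
    · rintro ⟨x, ⟨⟨a, ha, hxa⟩, h1⟩, ⟨⟨b, hb, hxb⟩, h2⟩⟩
      rw [StairMeet]
      refine StairMeet.mono ?_ ?_ ((ih _ _ _ _).2 ⟨_, h1, h2⟩)
      · exact fun c hc => ⟨hc.1, b, hb, hc.2.trans hxb⟩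
      · exact fun c hc => ⟨hc.1, a, ha, hc.2.trans hxa⟩

end StairMeet

namespace FarFamilies

variable {ι κ : Type*} {F M : ℕ → ℝ} {n : ℕ}

lemma symm {p : ι → Fin n → ℝ} {q : κ → Fin n → ℝ} (h : FarFamilies F M n p q) :
    FarFamilies F M n q p where
  one_le_factor := h.one_le_factor
  side_le_factor := h.side_le_factor
  one_le_left := h.one_le_right
  left_le := h.right_le
  one_le_right := h.one_le_left
  right_le := h.left_le
  far a b i := (h.far b a i).symm

lemma natCast_add_one_le_mul {p : ι → Fin n → ℝ} {q : κ → Fin n → ℝ} (h : FarFamilies F M n p q) (i : ℕ) :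
    (n : ℝ) + 1 ≤ (n + 1) * F i :=
  le_mul_of_one_le_right (by positivity) (h.one_le_factor i)

lemma far_of_le {p : ι → Fin n → ℝ} {q : κ → Fin n → ℝ} (h : FarFamilies F M n p q)
    {a : ι} {b : κ} {i : Fin n} (hab : p a i ≤ q b i) :
    (n + 1) * F i * p a i ≤ q b i := by
  refine (h.far a b i).resolve_right fun hc => ?_
  have h1 := h.natCast_add_one_le_mul i
  have h2 := h.one_le_right b i
  have h3 : (1 : ℝ) ≤ n := by exact_mod_cast Fin.pos i
  nlinarith

lemma lt_iff_far {p : ι → Fin n → ℝ} {q : κ → Fin n → ℝ} (h : FarFamilies F M n p q)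
    {a : ι} {b : κ} {i : Fin n} :
    p a i < q b i ↔ (n + 1) * F i * p a i ≤ q b i := by
  refine ⟨fun hab => h.far_of_le hab.le, fun hab => ?_⟩
  have h1 := h.natCast_add_one_le_mul i
  have h2 := h.one_le_left a i
  have h3 : (1 : ℝ) ≤ n := by exact_mod_cast Fin.pos i
  nlinarith

lemma lt_or_lt {p : ι → Fin n → ℝ} {q : κ → Fin n → ℝ} (h : FarFamilies F M n p q)
    (a : ι) (b : κ) (i : Fin n) : p a i < q b i ∨ q b i < p a i :=
  (h.far a b i).imp h.lt_iff_far.2 h.symm.lt_iff_far.2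

/-- Moving the first family slightly towards a point of the box and dropping the last coordinate
keeps the families far apart, with the same coordinatewise comparisons. -/
lemma perturb {p : ι → Fin (n + 1) → ℝ} {q : κ → Fin (n + 1) → ℝ}
    (h : FarFamilies F M (n + 1) p q) {ε : ℝ} (hε : 0 ≤ ε) (hεF : ε * ((n + 2) * F n) ≤ 1)
    {v : Fin n → ℝ} (hv : ∀ i, ε ≤ v i) (hvM : ∀ i, v i ≤ ε * M i) :
    FarFamilies F M n (fun a i => (1 - ε) * p a i.castSucc + v i) (fun b => Fin.init (q b)) ∧
      (∀ A : Set ι, ∀ B : Set κ,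
        StairMeet n A B (fun a => Fin.init (p a)) (fun b => Fin.init (q b)) ↔
        StairMeet n A B (fun a i => (1 - ε) * p a i.castSucc + v i) (fun b => Fin.init (q b))) := by
  have hFn := h.one_le_factor n
  have hn : (0 : ℝ) ≤ n := n.cast_nonneg
  have hε2 : ε * (n + 2) ≤ 1 := by
    have : ε * (n + 2) * 1 ≤ ε * (n + 2) * F n := by gcongr
    linarith
  have hε1 : ε ≤ 1 := by nlinarith
  have hvs : ∀ i, v i * (n + 2) ≤ 1 := by
    intro i
    have h1 : ε * M i ≤ ε * F n := by
      gcongr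
      exact h.side_le_factor i n i.2
    have h2 : v i * (n + 2) ≤ (ε * F n) * (n + 2) := by
      gcongr
      exact (hvM i).trans h1
    linarith
  have hlow : ∀ a b (i : Fin n), (n + 2) * F i * p a i.castSucc ≤ q b i.castSucc →
      (n + 1) * F i * ((1 - ε) * p a i.castSucc + v i) ≤ q b i.castSucc := by
    intro a b i hab
    have h1 := h.one_le_left a i.castSucc
    have hF := h.one_le_factor i
    refine le_trans ?_ hab
    have h2 : (n + 1) * ((1 - ε) * p a i.castSucc + v i) ≤ (n + 2) * p a i.castSucc := by
      have := hvs i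
      have h4 : 0 ≤ v i := hε.trans (hv i)
      have h5 : 0 ≤ ε * p a i.castSucc := by positivity
      nlinarith
    nlinarith
  have hhigh : ∀ a b (i : Fin n), (n + 2) * F i * q b i.castSucc ≤ p a i.castSucc →
      (n + 1) * F i * q b i.castSucc ≤ (1 - ε) * p a i.castSucc + v i := by
    intro a b i hab
    have h1 := h.one_le_left a i.castSucc
    have h2 := h.one_le_right b i.castSucc
    have hF := h.one_le_factor i
    have h3 : (n + 1 : ℝ) ≤ (1 - ε) * (n + 2) := by linarith
    have h4 : (1 - ε) * ((n + 2) * F i * q b i.castSucc) ≤ (1 - ε) * p a i.castSucc := by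
      gcongr
    have h5 : (n + 1) * (F i * q b i.castSucc) ≤ (1 - ε) * (n + 2) * (F i * q b i.castSucc) := by
      gcongr
    have h6 := hv i
    linarith
  have hcast : ((n + 1 : ℕ) : ℝ) + 1 = n + 2 := by push_cast; ring
  have hfar : FarFamilies F M n (fun a i => (1 - ε) * p a i.castSucc + v i)
      (fun b => Fin.init (q b)) := by
    refine ⟨h.one_le_factor, h.side_le_factor, fun a i => ?_, fun a i => ?_,
      fun b i => h.one_le_right b i.castSucc, fun b i => h.right_le b i.castSucc,
      fun a b i => ?_⟩
    · have h1 := h.one_le_left a i.castSucc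
      have h2 := hv i
      nlinarith
    · have h1 := h.left_le a i.castSucc
      have h2 := hvM i
      rw [Fin.val_castSucc] at h1
      nlinarith
    · have := h.far a b i.castSucc
      rw [hcast] at this
      exact this.imp (hlow a b i) (hhigh a b i)
  have hlt : ∀ a b (i : Fin n), p a i.castSucc < q b i.castSucc →
      (1 - ε) * p a i.castSucc + v i < q b i.castSucc := by
    intro a b i hab
    have h1 := h.lt_iff_far.1 hab
    rw [hcast] at h1
    exact hfar.lt_iff_far.2 (hlow a b i h1)
  have hgt : ∀ a b (i : Fin n), q b i.castSucc < p a i.castSucc →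
      q b i.castSucc < (1 - ε) * p a i.castSucc + v i := by
    intro a b i hab
    have h1 := h.symm.lt_iff_far.1 hab
    rw [hcast] at h1
    exact hfar.symm.lt_iff_far.2 (hhigh a b i h1)
  have hpq : ∀ a b (i : Fin n), p a i.castSucc ≤ q b i.castSucc ↔
      (1 - ε) * p a i.castSucc + v i ≤ q b i.castSucc := by
    intro a b i
    rcases h.lt_or_lt a b i.castSucc with hab | hab
    · exact iff_of_true hab.le (hlt a b i hab).le
    · exact iff_of_false hab.not_ge (hgt a b i hab).not_ge
  have hqp : ∀ a b (i : Fin n), q b i.castSucc ≤ p a i.castSucc ↔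
      q b i.castSucc ≤ (1 - ε) * p a i.castSucc + v i := by
    intro a b i
    rcases h.lt_or_lt a b i.castSucc with hab | hab
    · exact iff_of_false hab.not_ge (hlt a b i hab).not_ge
    · exact iff_of_true hab.le (hgt a b i hab).le
  exact ⟨hfar, fun A B => ⟨StairMeet.congr hpq hqp,
    StairMeet.congr (fun a b i => (hpq a b i).symm) (fun a b i => (hqp a b i).symm)⟩⟩

end FarFamilies

section Separation

variable {ι κ : Type*} {F M : ℕ → ℝ} {n : ℕ}

lemma StairMeet.not_separated_step
    (ih : ∀ {A : Set ι} {B : Set κ} {p : ι → Fin n → ℝ} {q : κ → Fin n → ℝ},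
      FarFamilies F M n p q → StairMeet n A B p q → ∀ g : Fin n → ℝ,
      ¬ ∀ a ∈ A, ∀ b ∈ B, ∑ i, g i * p a i < ∑ i, g i * q b i)
    {A : Set ι} {B : Set κ} {p : ι → Fin (n + 1) → ℝ} {q : κ → Fin (n + 1) → ℝ}
    (hF : FarFamilies F M (n + 1) p q) (h : StairMeet (n + 1) A B p q)
    {a₀ : ι} (ha₀ : a₀ ∈ A) {b₀ : κ} (hb₀ : b₀ ∈ B)
    (hmax : ∀ b ∈ B, q b (Fin.last n) ≤ q b₀ (Fin.last n))
    (hle : q b₀ (Fin.last n) ≤ p a₀ (Fin.last n)) (g : Fin (n + 1) → ℝ) :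
    ¬ ∀ a ∈ A, ∀ b ∈ B, ∑ i, g i * p a i < ∑ i, g i * q b i := by
  intro hsep
  have hFn := hF.one_le_factor n
  have hn : (0 : ℝ) ≤ n := n.cast_nonneg
  have hcast : ((n + 1 : ℕ) : ℝ) + 1 = n + 2 := by push_cast; ring
  obtain ⟨ε, hε⟩ : ∃ ε : ℝ, ε * ((n + 2) * F n) = 1 :=
    ⟨((n + 2) * F n)⁻¹, inv_mul_cancel₀ (by positivity)⟩
  have hε0 : 0 < ε := by
    by_contra! hc
    have : 0 < (n + 2) * F n := by positivity
    nlinarith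
  have hε1 : ε < 1 := by
    by_contra! hc
    have : 1 * ((n + 2) * F n) ≤ ε * ((n + 2) * F n) := by gcongr
    nlinarith
  simp only [Fin.sum_univ_castSucc] at hsep
  rw [StairMeet] at h
  have hscale : ∀ {s t : ℝ}, (n + 2) * F n * s ≤ t → s ≤ ε * t := by
    intro s t hst
    have := mul_le_mul_of_nonneg_left hst hε0.le
    rwa [← mul_assoc, hε, one_mul] at this
  have hsum : ∀ u v : Fin (n + 1) → ℝ,
      ∑ i : Fin n, g i.castSucc * ((1 - ε) * u i.castSucc + ε * v i.castSucc) =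
      (1 - ε) * ∑ i : Fin n, g i.castSucc * u i.castSucc +
        ε * ∑ i : Fin n, g i.castSucc * v i.castSucc := by
    intro u v
    rw [Finset.mul_sum, Finset.mul_sum, ← Finset.sum_add_distrib]
    exact Finset.sum_congr rfl fun i _ => by ring
  rcases le_or_gt 0 (g (Fin.last n)) with hg | hg
  · obtain ⟨hF', hiff⟩ := hF.perturb hε0.le hε.le (v := fun i => ε * p a₀ i.castSucc)
      (fun i => le_mul_of_one_le_right hε0.le (hF.one_le_left _ _))
      (fun i => mul_le_mul_of_nonneg_left (hF.left_le _ _) hε0.le)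
    refine ih hF' ((hiff _ _).1 h) (fun i => g i.castSucc) ?_
    rintro a ⟨ha, -⟩ b ⟨hb, -⟩
    have h1 := hF.symm.far_of_le ((hmax b hb).trans hle)
    rw [hcast] at h1
    have h2 := hscale h1
    have h3 := hsep a ha b hb
    have h4 := hsep a₀ ha₀ b hb
    have h5 := hF.one_le_left a (Fin.last n)
    have h6 : q b (Fin.last n) ≤ (1 - ε) * p a (Fin.last n) + ε * p a₀ (Fin.last n) := by
      nlinarith
    have h7 := mul_le_mul_of_nonneg_left h6 hg
    have h8 := mul_lt_mul_of_pos_left h3 (sub_pos.2 hε1)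
    have h9 := mul_lt_mul_of_pos_left h4 hε0
    simp only [Fin.init]
    rw [hsum]
    linarith
  · obtain ⟨hF', hiff⟩ := hF.symm.perturb hε0.le hε.le (v := fun i => ε * q b₀ i.castSucc)
      (fun i => le_mul_of_one_le_right hε0.le (hF.one_le_right _ _))
      (fun i => mul_le_mul_of_nonneg_left (hF.right_le _ _) hε0.le)
    refine ih hF'.symm ((hiff _ _).1 h.symm).symm (fun i => g i.castSucc) ?_
    rintro a ⟨ha, c, hc, hac⟩ b ⟨hb, -⟩
    have h1 := hF.far_of_le (hac.trans (hmax c hc))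
    rw [hcast] at h1
    have h2 := hscale h1
    have h3 := hsep a ha b hb
    have h4 := hsep a ha b₀ hb₀
    have h5 := hF.one_le_right b (Fin.last n)
    have h6 : p a (Fin.last n) ≤ (1 - ε) * q b (Fin.last n) + ε * q b₀ (Fin.last n) := by
      nlinarith
    have h7 := mul_le_mul_of_nonpos_left h6 hg.le
    have h8 := mul_lt_mul_of_pos_left h3 (sub_pos.2 hε1)
    have h9 := mul_lt_mul_of_pos_left h4 hε0
    simp only [Fin.init]
    rw [hsum]
    linarith

lemma StairMeet.not_separated [Finite ι] [Finite κ] {A : Set ι} {B : Set κ}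
    {p : ι → Fin n → ℝ} {q : κ → Fin n → ℝ} (hF : FarFamilies F M n p q)
    (h : StairMeet n A B p q) (g : Fin n → ℝ) :
    ¬ ∀ a ∈ A, ∀ b ∈ B, ∑ i, g i * p a i < ∑ i, g i * q b i := by
  induction n generalizing A B with
  | zero =>
    obtain ⟨⟨a, ha⟩, ⟨b, hb⟩⟩ := h
    exact fun hsep => by simpa using hsep a ha b hb
  | succ n ih =>
    obtain ⟨a₀, ha₀, hmaxa⟩ :=
      A.toFinite.exists_maximalFor (fun a => p a (Fin.last n)) A h.nonempty_left
    obtain ⟨b₀, hb₀, hmaxb⟩ :=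
      B.toFinite.exists_maximalFor (fun b => q b (Fin.last n)) B h.symm.nonempty_left
    rcases le_total (q b₀ (Fin.last n)) (p a₀ (Fin.last n)) with hle | hle
    · exact h.not_separated_step (fun hF h => ih hF h) hF ha₀ hb₀
        (fun b hb => (le_total _ _).elim id (hmaxb hb)) hle g
    · intro hsep
      refine h.symm.not_separated_step (fun {A B p q} hF h g hsep => ?_) hF.symm hb₀ ha₀
        (fun a ha => (le_total _ _).elim id (hmaxa ha)) hle (-g) fun b hb a ha => ?_
      · refine ih hF.symm h.symm (-g) fun a ha b hb => ?_
        simpa using hsep b hb a ha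
      · simpa using hsep a ha b hb

end Separation

section Weights

variable {ι κ : Type*} [Fintype ι] [Fintype κ] {F M : ℕ → ℝ} {n : ℕ}

/-- The convex hulls of two finite families share a point, in terms of convex weights. -/
def ConvexMeet (n : ℕ) (A : Set ι) (B : Set κ) (p : ι → Fin n → ℝ) (q : κ → Fin n → ℝ) :
    Prop :=
  ∃ w : ι → ℝ, ∃ u : κ → ℝ, (∀ a, 0 ≤ w a) ∧ (∀ b, 0 ≤ u b) ∧ (∀ a ∉ A, w a = 0) ∧
    (∀ b ∉ B, u b = 0) ∧ ∑ a, w a = 1 ∧ ∑ b, u b = 1 ∧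
    ∀ i, ∑ a, w a * p a i = ∑ b, u b * q b i

lemma ConvexMeet.symm {A : Set ι} {B : Set κ} {p : ι → Fin n → ℝ} {q : κ → Fin n → ℝ}
    (h : ConvexMeet n A B p q) : ConvexMeet n B A q p := by
  obtain ⟨w, u, hw, hu, hwA, huB, hw1, hu1, h⟩ := h
  exact ⟨u, w, hu, hw, huB, hwA, hu1, hw1, fun i => (h i).symm⟩

lemma ConvexMeet.nonempty_left {A : Set ι} {B : Set κ} {p : ι → Fin n → ℝ}
    {q : κ → Fin n → ℝ} (h : ConvexMeet n A B p q) : A.Nonempty := by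
  obtain ⟨w, -, -, -, hwA, -, hw1, -⟩ := h
  by_contra hA
  rw [Set.not_nonempty_iff_eq_empty] at hA
  simp [hwA, hA] at hw1

lemma ConvexMeet.stairMeet_step
    (ih : ∀ {A : Set ι} {B : Set κ} {p : ι → Fin n → ℝ} {q : κ → Fin n → ℝ},
      FarFamilies F M n p q → ConvexMeet n A B p q → StairMeet n A B p q)
    {A : Set ι} {B : Set κ} {p : ι → Fin (n + 1) → ℝ} {q : κ → Fin (n + 1) → ℝ}
    (hF : FarFamilies F M (n + 1) p q) (h : ConvexMeet (n + 1) A B p q)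
    {a₀ : ι} (ha₀ : a₀ ∈ A) {b₀ : κ} (hb₀ : b₀ ∈ B)
    (hmax : ∀ b ∈ B, q b (Fin.last n) ≤ q b₀ (Fin.last n))
    (hle : q b₀ (Fin.last n) ≤ p a₀ (Fin.last n)) :
    StairMeet (n + 1) A B p q := by
  classical
  obtain ⟨w, u, hw, hu, hwA, huB, hw1, hu1, hwu⟩ := h
  have hFn := hF.one_le_factor n
  have hn : (0 : ℝ) ≤ n := n.cast_nonneg
  have hcast : ((n + 1 : ℕ) : ℝ) + 1 = n + 2 := by push_cast; ring
  set L : Set ι := {a | a ∈ A ∧ ∃ b ∈ B, p a (Fin.last n) ≤ q b (Fin.last n)}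
  set wl : ι → ℝ := fun a => if a ∈ L then w a else 0 with hwl
  set wh : ι → ℝ := fun a => if a ∈ L then 0 else w a with hwh
  have hsplit : ∀ a, w a = wl a + wh a := by
    intro a
    by_cases ha : a ∈ L <;> simp [hwl, hwh, ha]
  have hwl0 : ∀ a, 0 ≤ wl a := by
    intro a
    by_cases ha : a ∈ L <;> simp [hwl, ha, hw]
  have hwh0 : ∀ a, 0 ≤ wh a := by
    intro a
    by_cases ha : a ∈ L <;> simp [hwh, ha, hw]
  set ε : ℝ := ∑ a, wh a with hεdef
  have hε0 : 0 ≤ ε := Finset.sum_nonneg fun a _ => hwh0 a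
  have hwl1 : ∑ a, wl a = 1 - ε := by
    rw [← hw1, hεdef, ← Finset.sum_sub_distrib]
    exact Finset.sum_congr rfl fun a _ => by rw [hsplit a]; ring
  have hq0 := hF.one_le_right b₀ (Fin.last n)
  have hhigh : ∀ a, wh a * ((n + 2) * F n * q b₀ (Fin.last n)) ≤ w a * p a (Fin.last n) := by
    intro a
    have hp := hF.one_le_left a (Fin.last n)
    by_cases ha : a ∈ L
    · simpa [hwh, ha] using mul_nonneg (hw a) (zero_le_one.trans hp)
    · by_cases haA : a ∈ A
      · have hlt : q b₀ (Fin.last n) ≤ p a (Fin.last n) := by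
          by_contra! hc
          exact ha ⟨haA, b₀, hb₀, hc.le⟩
        have h1 := hF.symm.far_of_le hlt
        rw [hcast] at h1
        simpa [hwh, ha] using mul_le_mul_of_nonneg_left h1 (hw a)
      · simp [hwh, ha, hwA a haA]
  have hεF : ε * ((n + 2) * F n) ≤ 1 := by
    have h1 : ε * ((n + 2) * F n * q b₀ (Fin.last n)) ≤ ∑ a, w a * p a (Fin.last n) := by
      rw [hεdef, Finset.sum_mul]
      exact Finset.sum_le_sum fun a _ => hhigh a
    have h2 : ∑ b, u b * q b (Fin.last n) ≤ 1 * q b₀ (Fin.last n) := by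
      rw [← hu1, Finset.sum_mul]
      refine Finset.sum_le_sum fun b _ => ?_
      by_cases hb : b ∈ B
      · exact mul_le_mul_of_nonneg_left (hmax b hb) (hu b)
      · simp [huB b hb]
    rw [hwu] at h1
    refine le_of_mul_le_mul_right ?_ (zero_lt_one.trans_le hq0)
    linarith
  have hε1 : ε < 1 := by
    by_contra! hc
    have : 1 * ((n + 2) * F n) ≤ ε * ((n + 2) * F n) := by gcongr
    nlinarith
  obtain ⟨hF', hiff⟩ := hF.perturb hε0 hεF (v := fun i => ∑ a, wh a * p a i.castSucc)
    (fun i => by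
      rw [hεdef]
      exact Finset.sum_le_sum fun a _ => le_mul_of_one_le_right (hwh0 a) (hF.one_le_left _ _))
    (fun i => by
      rw [hεdef, Finset.sum_mul]
      exact Finset.sum_le_sum fun a _ => mul_le_mul_of_nonneg_left (hF.left_le _ _) (hwh0 a))
  rw [StairMeet, hiff]
  have hpos : 0 < 1 - ε := sub_pos.2 hε1
  refine ih hF' ⟨fun a => wl a / (1 - ε), u, fun a => div_nonneg (hwl0 a) hpos.le, hu,
    fun a ha => ?_, fun b hb => huB b fun hbB => hb ⟨hbB, a₀, ha₀, (hmax b hbB).trans hle⟩, ?_,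
    hu1, fun i => ?_⟩
  · have : wl a = 0 := if_neg ha
    simp [this]
  · rw [← Finset.sum_div, hwl1, div_self hpos.ne']
  · have h1 : ∀ a, wl a / (1 - ε) *
        ((1 - ε) * p a i.castSucc + ∑ a, wh a * p a i.castSucc) =
        wl a * p a i.castSucc + wl a / (1 - ε) * ∑ a, wh a * p a i.castSucc := by
      intro a
      field_simp
    simp only [Fin.init, ← hwu, h1, hsplit, add_mul, Finset.sum_add_distrib]
    rw [← Finset.sum_mul, ← Finset.sum_div, hwl1, div_self hpos.ne', one_mul]

lemma ConvexMeet.stairMeet {A : Set ι} {B : Set κ} {p : ι → Fin n → ℝ} {q : κ → Fin n → ℝ}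
    (hF : FarFamilies F M n p q) (h : ConvexMeet n A B p q) : StairMeet n A B p q := by
  induction n generalizing A B with
  | zero => exact ⟨h.nonempty_left, h.symm.nonempty_left⟩
  | succ n ih =>
    obtain ⟨a₀, ha₀, hmaxa⟩ :=
      A.toFinite.exists_maximalFor (fun a => p a (Fin.last n)) A h.nonempty_left
    obtain ⟨b₀, hb₀, hmaxb⟩ :=
      B.toFinite.exists_maximalFor (fun b => q b (Fin.last n)) B h.symm.nonempty_left
    rcases le_total (q b₀ (Fin.last n)) (p a₀ (Fin.last n)) with hle | hle
    · exact h.stairMeet_step (fun hF h => ih hF h) hF ha₀ hb₀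
        (fun b hb => (le_total _ _).elim id (hmaxb hb)) hle
    · exact (h.symm.stairMeet_step (fun hF h => (ih hF.symm h.symm).symm) hF.symm hb₀ ha₀
        (fun a ha => (le_total _ _).elim id (hmaxa ha)) hle).symm

end Weights

lemma exists_separating_of_disjoint_convexHull {n : ℕ} (P Q : Finset (Fin n → ℝ))
    (h : Disjoint (convexHull ℝ (P : Set (Fin n → ℝ))) (convexHull ℝ (Q : Set (Fin n → ℝ)))) :
    ∃ g : Fin n → ℝ, ∀ x ∈ P, ∀ y ∈ Q, ∑ i, g i * x i < ∑ i, g i * y i := by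
  obtain ⟨f, s, t, hs, hst, ht⟩ := geometric_hahn_banach_compact_closed
    (convex_convexHull ℝ _) (P.finite_toSet.isCompact_convexHull ℝ)
    (convex_convexHull ℝ _) (Q.finite_toSet.isClosed_convexHull ℝ) h
  have hf : ∀ x, f x = ∑ i, f (Pi.single i 1) * x i := by
    intro x
    conv_lhs => rw [pi_eq_sum_univ' x]
    simp [mul_comm, map_sum]
  refine ⟨fun i => f (Pi.single i 1), fun x hx y hy => ?_⟩
  rw [← hf, ← hf]
  exact (hs x (subset_convexHull ℝ _ hx)).trans (hst.trans (ht y (subset_convexHull ℝ _ hy)))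

section Stretch

variable {d m : ℕ}

lemma two_pow_le_stretchK (d m : ℕ) (i : ℕ) : (2 : ℝ) ^ d ≤ stretchK d m i := by
  induction i with
  | zero => exact le_rfl
  | succ i ih =>
    exact le_mul_of_one_le_right (by positivity)
      (one_le_pow₀ ((one_le_pow₀ one_le_two).trans ih))

lemma one_le_stretchK (d m : ℕ) (i : ℕ) : 1 ≤ stretchK d m i :=
  (one_le_pow₀ one_le_two).trans (two_pow_le_stretchK d m i)

lemma stretchK_monotone (hm : 2 ≤ m) : Monotone (stretchK d m) := by
  refine monotone_nat_of_le_succ fun i => ?_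
  have h1 : stretchK d m i ≤ stretchK d m i ^ (m - 1) :=
    le_self_pow₀ (one_le_stretchK d m i) (by omega)
  exact h1.trans (le_mul_of_one_le_left (zero_le_one.trans ((one_le_stretchK d m i).trans h1))
    (one_le_pow₀ one_le_two))

lemma farFamilies_stretch (hm : 2 ≤ m) (P Q : Finset (Fin d → ℝ))
    (hP : ↑P ⊆ stretchBox d m) (hQ : ↑Q ⊆ stretchBox d m)
    (hfar : ∀ p ∈ P, ∀ q ∈ Q, FarApart m p q) :
    FarFamilies (fun i => stretchK d m i / 2 ^ d) (fun i => stretchK d m i ^ (m - 1)) d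
      (fun a : P => a.1) (fun b : Q => b.1) := by
  have hd : ((d : ℝ) + 1) ≤ 2 ^ d := by exact_mod_cast Nat.lt_two_pow_self
  have hfactor : ∀ i, ((d : ℝ) + 1) * (stretchK d m i / 2 ^ d) ≤ stretchK d m i := by
    intro i
    have hK := one_le_stretchK d m i
    rw [← mul_div_assoc, div_le_iff₀ (by positivity), mul_comm]
    gcongr
  refine ⟨fun i => ?_, fun i j hij => ?_, fun a i => (hP a.2 i).1, fun a i => (hP a.2 i).2,
    fun b i => (hQ b.2 i).1, fun b i => (hQ b.2 i).2, fun a b i => ?_⟩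
  · rw [le_div_iff₀ (by positivity), one_mul]
    exact two_pow_le_stretchK d m i
  · obtain ⟨j, rfl⟩ := Nat.exists_eq_succ_of_ne_zero (Nat.ne_zero_of_lt hij)
    rw [le_div_iff₀ (by positivity), stretchK, mul_comm]
    have := stretchK_monotone (d := d) hm (Nat.le_of_lt_succ hij)
    have := one_le_stretchK d m i
    gcongr
  · refine (hfar a.1 a.2 b.1 b.2 i).imp (le_trans ?_) (le_trans ?_)
    · exact mul_le_mul_of_nonneg_right (hfactor i) (zero_le_one.trans (hP a.2 i).1)
    · exact mul_le_mul_of_nonneg_right (hfactor i) (zero_le_one.trans (hQ b.2 i).1)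

end Stretch

lemma exists_weights_of_mem_convexHull {n : ℕ} (P : Finset (Fin n → ℝ)) {x : Fin n → ℝ}
    (hx : x ∈ convexHull ℝ (P : Set (Fin n → ℝ))) :
    ∃ w : P → ℝ, (∀ a, 0 ≤ w a) ∧ ∑ a, w a = 1 ∧ ∀ i, ∑ a, w a * a.1 i = x i := by
  obtain ⟨w, hw, hw1, hwx⟩ := Finset.mem_convexHull'.1 hx
  refine ⟨fun a => w a.1, fun a => hw a.1 a.2, ?_, fun i => ?_⟩
  · rw [← hw1]
    exact Finset.sum_coe_sort P w
  · rw [← hwx, Finset.sum_apply]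
    exact Finset.sum_coe_sort P fun y => w y * y i

/-- If `P, Q` are finite subsets of the bounding box of the stretched grid that are far
apart, then their stair-convex hulls intersect iff their convex hulls intersect. -/
theorem sconv_inter_iff_conv_inter (d m : ℕ) (hd : 2 ≤ d) (hm : 2 ≤ m)
    (P Q : Finset (Fin d → ℝ))
    (hP : ↑P ⊆ stretchBox d m) (hQ : ↑Q ⊆ stretchBox d m)
    (hfar : ∀ p ∈ P, ∀ q ∈ Q, FarApart m p q) :
    (sconv (↑P : Set (Fin d → ℝ)) ∩ sconv (↑Q : Set (Fin d → ℝ))).Nonempty ↔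
      (convexHull ℝ (↑P : Set (Fin d → ℝ)) ∩ convexHull ℝ (↑Q : Set (Fin d → ℝ))).Nonempty := by
  have hF := farFamilies_stretch hm P Q hP hQ hfar
  have hsconv : ∀ (R : Finset (Fin d → ℝ)) (x : Fin d → ℝ),
      x ∈ sconv (R : Set (Fin d → ℝ)) ↔
        InStairHull d Set.univ (fun a : R => a.1) x := by
    intro R x
    rw [← mem_sconv_image_iff]
    simp
  have hmeet : (sconv (↑P : Set (Fin d → ℝ)) ∩ sconv (↑Q : Set (Fin d → ℝ))).Nonempty ↔
      StairMeet d Set.univ Set.univ (fun a : P => a.1) (fun b : Q => b.1) := by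
    rw [stairMeet_iff_exists_inStairHull]
    exact exists_congr fun x => and_congr (hsconv P x) (hsconv Q x)
  rw [hmeet]
  constructor
  · intro h
    by_contra hc
    rw [Set.not_nonempty_iff_eq_empty, ← Set.disjoint_iff_inter_eq_empty] at hc
    obtain ⟨g, hg⟩ := exists_separating_of_disjoint_convexHull P Q hc
    exact h.not_separated hF g fun a _ b _ => hg a.1 a.2 b.1 b.2
  · rintro ⟨x, hxP, hxQ⟩
    obtain ⟨w, hw, hw1, hwx⟩ := exists_weights_of_mem_convexHull P hxP
    obtain ⟨u, hu, hu1, hux⟩ := exists_weights_of_mem_convexHull Q hxQ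
    exact ConvexMeet.stairMeet hF ⟨w, u, hw, hu, by simp, by simp, hw1, hu1,
      fun i => (hwx i).trans (hux i).symm⟩
end
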